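/- Let n ≥ 2, let Ω ⊂ ℝⁿ be open, and let A be a Young function; if n ≥ 3 assume that ∫^∞ (t/A(t))^{1/(n−2)} dt < ∞. Let σ : [0,∞) → [0,∞) be a continuous function such that ∫^∞ A_{n−1}(λt) / ( t σ(t) A_{n−1}(t) ) dt = ∞ for every λ > 0, and set Ψ(t) = σ(t) A_{n−1}(t). Then every weakly monotone function u ∈ W^{1,A}_loc(Ω) admits a representative whose restriction to the complement in Ω of an exceptional set of C_{Ψ,1}-capacity zero is continuous. -/

import Mathlib

open MeasureTheory Metric Set Filter ENNReal
open scoped Topology NNReal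

noncomputable section

/-- Euclidean space `ℝⁿ`. -/
abbrev Euc (n : ℕ) : Type := EuclideanSpace ℝ (Fin n)

/-- A Young function: a convex function `A : [0,∞) → [0,∞]` with `A 0 = 0`,
not constant on `(0,∞)`.  (Only values on `[0,∞)` are relevant.) -/
def IsYoung (A : ℝ → ℝ≥0∞) : Prop :=
  A 0 = 0 ∧
    (∀ ⦃x y : ℝ⦄, 0 ≤ x → 0 ≤ y → ∀ ⦃l : ℝ⦄, 0 ≤ l → l ≤ 1 →
      A (l * x + (1 - l) * y) ≤ ENNReal.ofReal l * A x + ENNReal.ofReal (1 - l) * A y) ∧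
    ∃ x y : ℝ, 0 < x ∧ 0 < y ∧ A x ≠ A y

/-- The Young conjugate `Ã(t) = sup { s·t − A(s) : s ≥ 0 }`. -/
def youngConj (A : ℝ → ℝ≥0∞) (t : ℝ) : ℝ≥0∞ :=
  ⨆ s : Ici (0 : ℝ), (ENNReal.ofReal ((s : ℝ) * t) - A s)

/-- The exponent `(n-1)/(n-2)`. -/
def youngExp (n : ℕ) : ℝ := ((n : ℝ) - 1) / ((n : ℝ) - 2)

/-- The Young function `A_{n-1}`; equal to `A` for `n = 2`, and for `n ≥ 3` the
Young conjugate of `t ↦ t^{(n-1)/(n-2)} ∫_t^∞ Ã(r) r^{-1-(n-1)/(n-2)} dr`. -/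
def youngShifted (n : ℕ) (A : ℝ → ℝ≥0∞) : ℝ → ℝ≥0∞ :=
  if n = 2 then A
  else youngConj fun t =>
    ENNReal.ofReal (t ^ youngExp n) *
      ∫⁻ r in Ioi t, youngConj A r / ENNReal.ofReal (r ^ (1 + youngExp n))

/-- The generalized right-continuous inverse of a Young function. -/
def youngInv (A : ℝ → ℝ≥0∞) (τ : ℝ≥0∞) : ℝ≥0∞ :=
  ⨅ (s : ℝ) (_ : 0 ≤ s ∧ τ < A s), ENNReal.ofReal s

/-- The condition `∫^∞ (t/A(t))^{1/(n-2)} dt < ∞`. -/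
def TailCondition (n : ℕ) (A : ℝ → ℝ≥0∞) : Prop :=
  ∃ t₀ : ℝ, 0 < t₀ ∧
    ∫⁻ t in Ioi t₀, (ENNReal.ofReal t / A t) ^ (1 / ((n : ℝ) - 2)) < ∞

/-- The Δ₂-condition near infinity. -/
def Delta2Infty (A : ℝ → ℝ≥0∞) : Prop :=
  ∃ C : ℝ, 2 < C ∧ ∃ t₀ : ℝ, 0 ≤ t₀ ∧ ∀ t : ℝ, t₀ ≤ t → A (2 * t) ≤ ENNReal.ofReal C * A t

/-- `g` is the weak gradient of `u` on the open set `Ω`, with `u` and `g`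
locally integrable on `Ω`. -/
def IsWeakGradOn {n : ℕ} (Ω : Set (Euc n)) (u : Euc n → ℝ) (g : Euc n → Euc n) : Prop :=
  LocallyIntegrableOn u Ω volume ∧ LocallyIntegrableOn (fun x => ‖g x‖) Ω volume ∧
    ∀ φ : Euc n → ℝ, ContDiff ℝ (⊤ : ℕ∞) φ → HasCompactSupport φ → tsupport φ ⊆ Ω →
      ∀ i : Fin n,
        ∫ x, u x * fderiv ℝ φ x (EuclideanSpace.single i 1) = - ∫ x, g x i * φ x

/-- Membership in the Orlicz space `L^A(s)` (finiteness of the Luxemburg norm). -/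
def MemOrliczOn {n : ℕ} (A : ℝ → ℝ≥0∞) (s : Set (Euc n)) (f : Euc n → ℝ) : Prop :=
  ∃ lam : ℝ, 0 < lam ∧ ∫⁻ x in s, A (|f x| / lam) < ∞

/-- `u ∈ W^{1,A}_loc(Ω)`, with weak gradient `g`. -/
def MemW1Aloc {n : ℕ} (A : ℝ → ℝ≥0∞) (Ω : Set (Euc n)) (u : Euc n → ℝ)
    (g : Euc n → Euc n) : Prop :=
  IsWeakGradOn Ω u g ∧
    ∀ Ω' : Set (Euc n), IsOpen Ω' → IsCompact (closure Ω') → closure Ω' ⊆ Ω →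
      MemOrliczOn A Ω' u ∧ MemOrliczOn A Ω' (fun x => ‖g x‖)

/-- `v ∈ W^{1,1}_0(Ω')`: `v` has a weak gradient on `Ω'` and is approximable in the
`W^{1,1}(Ω')` norm by smooth functions compactly supported in `Ω'`. -/
def MemW110 {n : ℕ} (Ω' : Set (Euc n)) (v : Euc n → ℝ) : Prop :=
  ∃ h : Euc n → Euc n, IsWeakGradOn Ω' v h ∧
    ∃ φ : ℕ → Euc n → ℝ,
      (∀ k, ContDiff ℝ (⊤ : ℕ∞) (φ k) ∧ HasCompactSupport (φ k) ∧ tsupport (φ k) ⊆ Ω') ∧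
      Tendsto (fun k => ∫ x in Ω', (|φ k x - v x| + ‖gradient (φ k) x - h x‖))
        atTop (𝓝 0)

/-- `u` is weakly monotone on `Ω`. -/
def WeaklyMonotone {n : ℕ} (Ω : Set (Euc n)) (u : Euc n → ℝ) : Prop :=
  ∀ Ω' : Set (Euc n), IsOpen Ω' → IsCompact (closure Ω') → closure Ω' ⊆ Ω →
    ∀ m M : ℝ, m ≤ M →
      MemW110 Ω' (fun x => max (u x - M) 0 - max (m - u x) 0) →
      ∀ᵐ x ∂volume.restrict Ω', m ≤ u x ∧ u x ≤ M

/-- The essential oscillation of `u` on a set `s`. -/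
def essOsc {n : ℕ} (s : Set (Euc n)) (u : Euc n → ℝ) : ℝ≥0∞ :=
  essSup (fun p : Euc n × Euc n => ENNReal.ofReal |u p.1 - u p.2|)
    ((volume.restrict s).prod (volume.restrict s))

/-- The Riesz-type kernel `1 / (|x-y|ⁿ Ψ(1/|x-y|))`. -/
def rieszKernel {n : ℕ} (Ψ : ℝ → ℝ≥0∞) (x y : Euc n) : ℝ≥0∞ :=
  (ENNReal.ofReal (‖x - y‖ ^ n) * Ψ (1 / ‖x - y‖))⁻¹

/-- The Riesz-type potential `I_Ψ f`. -/
def rieszPot {n : ℕ} (Ψ : ℝ → ℝ≥0∞) (f : Euc n → ℝ≥0∞) (x : Euc n) : ℝ≥0∞ :=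
  ∫⁻ y, f y * rieszKernel Ψ x y

/-- The capacity `C_{Ψ,1}`. -/
def capPsi {n : ℕ} (Ψ : ℝ → ℝ≥0∞) (E : Set (Euc n)) : ℝ≥0∞ :=
  ⨅ (f : Euc n → ℝ≥0∞) (_ : Measurable f) (_ : ∀ x ∈ E, 1 ≤ rieszPot Ψ f x),
    ∫⁻ x, f x

section Polar

variable {E : Type*} [NormedAddCommGroup E] [MeasurableSpace E] [BorelSpace E]

/-- Integration in polar coordinates. -/
theorem lintegral_eq_lintegral_sphere [NormedSpace ℝ E] [FiniteDimensional ℝ E] [Nontrivial E]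
    (μ : Measure E) [μ.IsAddHaarMeasure] {f : E → ℝ≥0∞} (hf : Measurable f) :
    ∫⁻ x, f x ∂μ = ∫⁻ θ : sphere (0 : E) 1, (∫⁻ r in Ioi (0 : ℝ),
      ENNReal.ofReal (r ^ (Module.finrank ℝ E - 1)) * f (r • (θ : E))) ∂μ.toSphere := by
  have h1 := μ.measurePreserving_homeomorphUnitSphereProd
  have hmeas : Measurable fun p : sphere (0 : E) 1 × Ioi (0 : ℝ) => f ((p.2 : ℝ) • (p.1 : E)) := by
    fun_prop
  have h2 := h1.lintegral_comp hmeas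
  have h3 : ∀ x : ({0}ᶜ : Set E),
      f (((homeomorphUnitSphereProd E x).2 : ℝ) • ((homeomorphUnitSphereProd E x).1 : E))
        = f x := by
    intro x
    congr 1
    have := (homeomorphUnitSphereProd E).symm_apply_apply x
    conv_rhs => rw [← this]
    rfl
  simp only [h3] at h2
  have h4 : ∫⁻ x : ({0}ᶜ : Set E), f x ∂(μ.comap (↑)) = ∫⁻ x, f x ∂μ := by
    rw [lintegral_subtype_comap (measurableSet_singleton (0 : E)).compl f,
      restrict_compl_singleton]
  rw [← h4, h2, lintegral_prod _ hmeas.aemeasurable]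
  refine lintegral_congr fun θ => ?_
  rw [Measure.volumeIoiPow, lintegral_withDensity_eq_lintegral_mul _ (by fun_prop) (by fun_prop)]
  simp only [Pi.mul_apply]
  exact lintegral_subtype_comap measurableSet_Ioi
    (fun r : ℝ => ENNReal.ofReal (r ^ (Module.finrank ℝ E - 1)) * f (r • (θ : E)))

/-- Integration in polar coordinates, with the radial integral outside. -/
theorem lintegral_eq_lintegral_radius [NormedSpace ℝ E] [FiniteDimensional ℝ E] [Nontrivial E]
    (μ : Measure E) [μ.IsAddHaarMeasure] {f : E → ℝ≥0∞} (hf : Measurable f) :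
    ∫⁻ x, f x ∂μ = ∫⁻ r in Ioi (0 : ℝ), ENNReal.ofReal (r ^ (Module.finrank ℝ E - 1)) *
      ∫⁻ θ : sphere (0 : E) 1, f (r • (θ : E)) ∂μ.toSphere := by
  rw [lintegral_eq_lintegral_sphere μ hf, lintegral_lintegral_swap]
  · refine lintegral_congr fun r => ?_
    rw [lintegral_const_mul]
    fun_prop
  · apply Measurable.aemeasurable
    unfold Function.uncurry
    fun_prop

variable [InnerProductSpace ℝ E] [FiniteDimensional ℝ E]

/-- The decomposition of the space into the axis `a` and its orthogonal complement. -/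
theorem measurePreserving_axis {a : E} (ha : ‖a‖ = 1) :
    MeasurePreserving (fun p : ℝ × (ℝ ∙ a)ᗮ => p.1 • a + (p.2 : E)) := by
  let L : WithLp 2 (ℝ × (ℝ ∙ a)ᗮ) →ₗ[ℝ] E :=
    { toFun := fun p => p.fst • a + (p.snd : E)
      map_add' := by
        intro x y
        simp only [WithLp.add_fst, WithLp.add_snd, Submodule.coe_add]
        module
      map_smul' := by
        intro c x
        simp only [WithLp.smul_fst, WithLp.smul_snd, Submodule.coe_smul, RingHom.id_apply,
          smul_eq_mul]
        module }
  have hL : ∀ p, ‖L p‖ = ‖p‖ := by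
    intro p
    have horth : inner ℝ (p.fst • a) (p.snd : E) = 0 :=
      Submodule.inner_right_of_mem_orthogonal
        (Submodule.smul_mem _ _ (Submodule.mem_span_singleton_self a)) p.snd.2
    have h1 := norm_add_sq_eq_norm_sq_add_norm_sq_of_inner_eq_zero _ _ horth
    have h2 := WithLp.prod_norm_sq_eq_of_L2 p
    rw [norm_smul, ha, mul_one] at h1
    have h3 : ‖L p‖ * ‖L p‖ = ‖p‖ * ‖p‖ := by
      rw [← sq ‖p‖, h2, sq, sq]
      exact h1
    nlinarith [norm_nonneg (L p), norm_nonneg p]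
  let I : WithLp 2 (ℝ × (ℝ ∙ a)ᗮ) →ₗᵢ[ℝ] E := ⟨L, hL⟩
  have ha0 : a ≠ 0 := by
    rintro rfl
    simp at ha
  have hfin : Module.finrank ℝ (WithLp 2 (ℝ × (ℝ ∙ a)ᗮ)) = Module.finrank ℝ E := by
    rw [(WithLp.linearEquiv 2 ℝ (ℝ × (ℝ ∙ a)ᗮ)).finrank_eq, Module.finrank_prod,
      ← (ℝ ∙ a).finrank_add_finrank_orthogonal, finrank_span_singleton ha0, Module.finrank_self]
  have h := (I.toLinearIsometryEquiv hfin).measurePreserving.comp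
    (WithLp.volume_preserving_toLp ℝ (ℝ ∙ a)ᗮ)
  exact h

/-- The half plane in polar coordinates. -/
theorem lintegral_halfPlane_polar {g : ℝ × ℝ → ℝ≥0∞} (hg : Measurable g) :
    ∫⁻ s : ℝ, ∫⁻ ρ in Ioi (0 : ℝ), g (s, ρ) =
      ∫⁻ t in Ioo 0 Real.pi, ∫⁻ R in Ioi (0 : ℝ),
        ENNReal.ofReal R * g (R * Real.cos t, R * Real.sin t) := by
  let G : ℝ × ℝ → ℝ≥0∞ := {p : ℝ × ℝ | 0 < p.2}.indicator g
  have hG : Measurable G := hg.indicator (measurableSet_lt measurable_const measurable_snd)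
  have h1 : ∫⁻ s : ℝ, ∫⁻ ρ in Ioi (0 : ℝ), g (s, ρ) = ∫⁻ p : ℝ × ℝ, G p := by
    rw [Measure.volume_eq_prod, lintegral_prod _ hG.aemeasurable]
    refine lintegral_congr fun s => ?_
    rw [← lintegral_indicator measurableSet_Ioi]
    rfl
  have hG2 : Measurable fun p : ℝ × ℝ => ENNReal.ofReal p.1 • G (polarCoord.symm p) := by
    have : Measurable fun p : ℝ × ℝ => polarCoord.symm p := by
      simp only [polarCoord_symm_apply]
      fun_prop
    exact (by fun_prop : Measurable fun p : ℝ × ℝ => ENNReal.ofReal p.1).smul (hG.comp this)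
  rw [h1, ← lintegral_comp_polarCoord_symm, polarCoord_target, Measure.volume_eq_prod,
    ← Measure.prod_restrict, lintegral_prod_symm _ hG2.aemeasurable]
  have hsub : Ioo 0 Real.pi ⊆ Ioo (-Real.pi) Real.pi :=
    Ioo_subset_Ioo_left (by linarith [Real.pi_pos])
  rw [← inter_eq_self_of_subset_left hsub, ← setLIntegral_indicator measurableSet_Ioo]
  refine setLIntegral_congr_fun measurableSet_Ioo fun t ht => ?_
  by_cases h0 : 0 < t
  · rw [indicator_of_mem (show t ∈ Ioo 0 Real.pi from ⟨h0, ht.2⟩)]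
    refine setLIntegral_congr_fun measurableSet_Ioi fun R hR => ?_
    have hpos : 0 < R * Real.sin t := mul_pos hR (Real.sin_pos_of_pos_of_lt_pi h0 ht.2)
    simp only [polarCoord_symm_apply, smul_eq_mul]
    congr 1
    exact indicator_of_mem (s := {p : ℝ × ℝ | 0 < p.2}) hpos g
  · rw [indicator_of_notMem (fun h : t ∈ Ioo 0 Real.pi => h0 h.1)]
    refine (setLIntegral_congr_fun (measurableSet_Ioi (a := (0 : ℝ))) (g := fun _ => 0)
      fun R hR => ?_).trans
      lintegral_zero
    have hneg : R * Real.sin t ≤ 0 :=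
      mul_nonpos_of_nonneg_of_nonpos (le_of_lt hR)
        (Real.sin_nonpos_of_nonpos_of_neg_pi_le (not_lt.1 h0) ht.1.le)
    simp only [polarCoord_symm_apply, smul_eq_mul]
    rw [show G (R * Real.cos t, R * Real.sin t) = 0 from
      indicator_of_notMem (s := {p : ℝ × ℝ | 0 < p.2}) (not_lt.2 hneg) g, mul_zero]

/-- The unit sphere in polar coordinates about the axis `a`. -/
theorem lintegral_sphere_eq_lintegral_axis {m : ℕ} (hm : 1 ≤ m)
    (hfin : Module.finrank ℝ E = m + 1) {a : E} (ha : ‖a‖ = 1)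
    {f : E → ℝ≥0∞} (hf : Measurable f) :
    ∫⁻ θ : sphere (0 : E) 1, f θ ∂(volume : Measure E).toSphere =
      ∫⁻ v : sphere (0 : (ℝ ∙ a)ᗮ) 1, (∫⁻ t in Ioo 0 Real.pi,
        ENNReal.ofReal (Real.sin t ^ (m - 1)) *
          f (Real.cos t • a + Real.sin t • ((v : (ℝ ∙ a)ᗮ) : E)))
        ∂(volume : Measure (ℝ ∙ a)ᗮ).toSphere := by
  have ha0 : a ≠ 0 := by
    rintro rfl
    simp at ha
  have hfV : Module.finrank ℝ (ℝ ∙ a)ᗮ = m := by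
    have := (ℝ ∙ a).finrank_add_finrank_orthogonal
    rw [finrank_span_singleton ha0, hfin] at this
    omega
  have : Nontrivial E := ⟨a, 0, ha0⟩
  have : Nontrivial (ℝ ∙ a)ᗮ := Module.nontrivial_of_finrank_pos (R := ℝ) (by omega)
  let G : E → ℝ≥0∞ := (ball (0 : E) 1).indicator fun x => f (‖x‖⁻¹ • x)
  have hG : Measurable G := (hf.comp (by fun_prop)).indicator measurableSet_ball
  have hrad : ∀ r : ℝ, 0 < r → ∀ θ : E, ‖θ‖ = 1 →
      G (r • θ) = (Iio (1 : ℝ)).indicator 1 r * f θ := by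
    intro r hr θ hθ
    have hn : ‖r • θ‖ = r := by rw [norm_smul, hθ, mul_one, Real.norm_of_nonneg hr.le]
    by_cases h1 : r < 1
    · have : G (r • θ) = f (‖r • θ‖⁻¹ • r • θ) :=
        indicator_of_mem (by simpa [hn] using h1) _
      rw [this, hn, smul_smul, inv_mul_cancel₀ hr.ne', one_smul,
        indicator_of_mem (mem_Iio.2 h1), Pi.one_apply, one_mul]
    · have : G (r • θ) = 0 := indicator_of_notMem (by simpa [hn] using h1) _
      rw [this, indicator_of_notMem (by simpa using h1), zero_mul]
  have hcm : Measurable fun r : ℝ => ENNReal.ofReal (r ^ m) * (Iio (1 : ℝ)).indicator 1 r :=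
    (by fun_prop : Measurable fun r : ℝ => ENNReal.ofReal (r ^ m)).mul
      (measurable_one.indicator measurableSet_Iio)
  set c : ℝ≥0∞ := ∫⁻ r in Ioi (0 : ℝ), ENNReal.ofReal (r ^ m) * (Iio (1 : ℝ)).indicator 1 r with hc
  have hc_top : c ≠ ⊤ := by
    have : c ≤ ∫⁻ r in Ioi (0 : ℝ), (Iio (1 : ℝ)).indicator 1 r := by
      refine setLIntegral_mono_ae (measurable_one.indicator measurableSet_Iio).aemeasurable
        (ae_of_all _ fun r hr => ?_)
      by_cases h1 : r < 1
      · simpa [h1] using pow_le_one₀ (le_of_lt hr) h1.le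
      · simp [h1]
    refine ne_top_of_le_ne_top ?_ this
    rw [setLIntegral_indicator measurableSet_Iio]
    simp [Iio_inter_Ioi]
  have hc_zero : c ≠ 0 := by
    rw [hc, Ne, lintegral_eq_zero_iff hcm]
    intro h
    have h2 : ∀ᵐ r ∂(volume.restrict (Ioi (0 : ℝ))), 1 ≤ r := by
      filter_upwards [h, ae_restrict_mem measurableSet_Ioi] with r hr h0
      by_contra h1
      have h1' : r < 1 := not_le.1 h1
      have h0' : (0 : ℝ) < r := h0
      simp only [indicator_of_mem (mem_Iio.2 h1'), Pi.one_apply, mul_one, Pi.zero_apply,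
        ENNReal.ofReal_eq_zero] at hr
      exact absurd hr (not_le.2 (pow_pos h0' m))
    rw [ae_iff, Measure.restrict_apply' measurableSet_Ioi] at h2
    have h3 : {r : ℝ | ¬ 1 ≤ r} ∩ Ioi 0 = Ioo 0 1 := by
      ext r
      simp [and_comm]
    rw [h3] at h2
    simp at h2
  have hL : ∫⁻ x, G x = c * ∫⁻ θ : sphere (0 : E) 1, f θ ∂(volume : Measure E).toSphere := by
    rw [lintegral_eq_lintegral_sphere volume hG, hfin, ← lintegral_const_mul _ (by fun_prop)]
    refine lintegral_congr fun θ => ?_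
    rw [hc, ← lintegral_mul_const _ hcm]
    refine setLIntegral_congr_fun measurableSet_Ioi fun r hr => ?_
    simp only [Nat.add_sub_cancel]
    rw [hrad r hr θ (by simp), mul_assoc]
  have hR : ∫⁻ x, G x = c * ∫⁻ v : sphere (0 : (ℝ ∙ a)ᗮ) 1, (∫⁻ t in Ioo 0 Real.pi,
        ENNReal.ofReal (Real.sin t ^ (m - 1)) *
          f (Real.cos t • a + Real.sin t • ((v : (ℝ ∙ a)ᗮ) : E)))
          ∂(volume : Measure (ℝ ∙ a)ᗮ).toSphere := by
    rw [← (measurePreserving_axis ha).lintegral_comp hG, Measure.volume_eq_prod,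
      lintegral_prod _ (by fun_prop)]
    have h1 : ∀ s : ℝ, ∫⁻ y : (ℝ ∙ a)ᗮ, G (s • a + (y : E)) =
        ∫⁻ v : sphere (0 : (ℝ ∙ a)ᗮ) 1, (∫⁻ ρ in Ioi (0 : ℝ), ENNReal.ofReal (ρ ^ (m - 1)) *
          G (s • a + ρ • ((v : (ℝ ∙ a)ᗮ) : E))) ∂(volume : Measure (ℝ ∙ a)ᗮ).toSphere := by
      intro s
      rw [lintegral_eq_lintegral_sphere volume (by fun_prop), hfV]
      rfl
    simp only [h1]
    rw [lintegral_lintegral_swap, ← lintegral_const_mul _ (by fun_prop)]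
    · refine lintegral_congr fun v => ?_
      have hv : ‖((v : (ℝ ∙ a)ᗮ) : E)‖ = 1 := by
        have : ‖(v : (ℝ ∙ a)ᗮ)‖ = 1 := by simp
        exact this
      have horth : inner ℝ a ((v : (ℝ ∙ a)ᗮ) : E) = 0 :=
        Submodule.inner_right_of_mem_orthogonal (Submodule.mem_span_singleton_self a) v.1.2
      have hpol := lintegral_halfPlane_polar (g := fun p : ℝ × ℝ =>
        ENNReal.ofReal (p.2 ^ (m - 1)) * G (p.1 • a + p.2 • ((v : (ℝ ∙ a)ᗮ) : E))) (by fun_prop)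
      simp only at hpol
      rw [hpol, ← lintegral_const_mul _ (by fun_prop)]
      refine setLIntegral_congr_fun measurableSet_Ioo fun t ht => ?_
      rw [hc, ← lintegral_mul_const _ hcm]
      refine setLIntegral_congr_fun measurableSet_Ioi fun R hR => ?_
      have hR' : (0 : ℝ) < R := hR
      have hsin : 0 < Real.sin t := Real.sin_pos_of_pos_of_lt_pi ht.1 ht.2
      have hnorm : ‖Real.cos t • a + Real.sin t • ((v : (ℝ ∙ a)ᗮ) : E)‖ = 1 := by
        have h := norm_add_sq_real (Real.cos t • a) (Real.sin t • ((v : (ℝ ∙ a)ᗮ) : E))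
        rw [inner_smul_left, inner_smul_right, horth, norm_smul, norm_smul, ha, hv] at h
        simp only [mul_one, mul_zero, add_zero, Real.norm_eq_abs, sq_abs,
          Real.cos_sq_add_sin_sq] at h
        nlinarith [norm_nonneg (Real.cos t • a + Real.sin t • ((v : (ℝ ∙ a)ᗮ) : E))]
      simp only [mul_smul, ← smul_add]
      rw [hrad R hR' _ hnorm, mul_pow, ENNReal.ofReal_mul (by positivity)]
      obtain ⟨k, rfl⟩ : ∃ k, m = k + 1 := ⟨m - 1, by omega⟩
      simp only [Nat.add_sub_cancel]
      rw [pow_succ R k, ENNReal.ofReal_mul (by positivity)]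
      ring
    · apply Measurable.aemeasurable
      unfold Function.uncurry
      have : Measurable fun q : (ℝ × sphere (0 : (ℝ ∙ a)ᗮ) 1) × ℝ =>
          ENNReal.ofReal (q.2 ^ (m - 1)) *
            G (q.1.1 • a + q.2 • ((q.1.2 : (ℝ ∙ a)ᗮ) : E)) := by fun_prop
      exact this.lintegral_prod_right'
  exact (ENNReal.mul_right_inj hc_zero hc_top).1 (hL.symm.trans hR)

end Polar

section Young

theorem IsYoung.mono {A : ℝ → ℝ≥0∞} (hA : IsYoung A) {x y : ℝ} (hx : 0 ≤ x) (hxy : x ≤ y) :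
    A x ≤ A y := by
  rcases hx.eq_or_lt with rfl | hx0
  · simp [hA.1]
  have hy : 0 < y := hx0.trans_le hxy
  have h := hA.2.1 hy.le le_rfl (l := x / y) (by positivity) ((div_le_one hy).2 hxy)
  rw [hA.1, mul_zero, mul_zero, add_zero, add_zero, div_mul_cancel₀ _ hy.ne'] at h
  refine h.trans (mul_le_of_le_one_left' ?_)
  exact ENNReal.ofReal_le_one.2 ((div_le_one hy).2 hxy)

theorem IsYoung.measurable_max {A : ℝ → ℝ≥0∞} (hA : IsYoung A) :
    Measurable fun t : ℝ => A (max t 0) := by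
  refine Monotone.measurable fun x y hxy => ?_
  exact hA.mono (le_max_right _ _) (max_le_max_right 0 hxy)

theorem IsYoung.measurable_comp {A : ℝ → ℝ≥0∞} (hA : IsYoung A) {α : Type*} [MeasurableSpace α]
    {f : α → ℝ} (hf : Measurable f) (h0 : ∀ x, 0 ≤ f x) : Measurable fun x => A (f x) := by
  simpa only [Function.comp_def, max_eq_left (h0 _)] using hA.measurable_max.comp hf

theorem young_inequality (A : ℝ → ℝ≥0∞) {s : ℝ} (hs : 0 ≤ s) (t : ℝ) :
    ENNReal.ofReal (s * t) ≤ A s + youngConj A t := by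
  have h : ENNReal.ofReal (s * t) - A s ≤ youngConj A t :=
    le_iSup (fun s : Ici (0 : ℝ) => ENNReal.ofReal ((s : ℝ) * t) - A s) ⟨s, hs⟩
  exact tsub_le_iff_left.1 h

theorem youngConj_mono (A : ℝ → ℝ≥0∞) : Monotone (youngConj A) := by
  intro x y hxy
  refine iSup_mono fun s => tsub_le_tsub_right (ENNReal.ofReal_le_ofReal ?_) _
  exact mul_le_mul_of_nonneg_left hxy s.2

/-- A weak form of the Jensen inequality. -/
theorem IsYoung.le_lintegral {A : ℝ → ℝ≥0∞} (hA : IsYoung A) {α : Type*} [MeasurableSpace α]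
    {μ : Measure α} [IsProbabilityMeasure μ] {h : α → ℝ} (h0 : ∀ x, 0 ≤ h x) {s : ℝ}
    (hs : ENNReal.ofReal (2 * s) ≤ ∫⁻ x, ENNReal.ofReal (h x) ∂μ) (hs0 : 0 ≤ s) :
    A s ≤ ∫⁻ x, A (h x) ∂μ := by
  rcases hs0.eq_or_lt with rfl | hspos
  · simp [hA.1]
  refine ENNReal.le_of_forall_nnreal_lt fun c hc => ?_
  set τ : ℝ := c / s with hτ
  have hτ0 : 0 ≤ τ := by positivity
  have hτs : s * τ = c := by rw [hτ]; field_simp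
  have hpt : ∀ x, ENNReal.ofReal (h x) * ENNReal.ofReal τ ≤ A (h x) + c := by
    intro x
    rw [← ENNReal.ofReal_mul (h0 x)]
    rcases le_total (h x) s with hle | hge
    · refine le_trans ?_ le_add_self
      rw [← ENNReal.ofReal_coe_nnreal, ← hτs]
      exact ENNReal.ofReal_le_ofReal (mul_le_mul_of_nonneg_right hle hτ0)
    · refine le_trans ?_ le_self_add
      have hhx : 0 < h x := hspos.trans_le hge
      have hconv := hA.2.1 hhx.le le_rfl (l := s / h x) (by positivity) ((div_le_one hhx).2 hge)
      rw [hA.1, mul_zero, mul_zero, add_zero, add_zero, div_mul_cancel₀ _ hhx.ne'] at hconv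
      have h1 : (c : ℝ≥0∞) ≤ ENNReal.ofReal (s / h x) * A (h x) := hc.le.trans hconv
      have h2 : h x * τ = h x / s * c := by rw [hτ]; ring
      calc ENNReal.ofReal (h x * τ) = ENNReal.ofReal (h x / s) * c := by
            rw [h2, ENNReal.ofReal_mul (by positivity), ENNReal.ofReal_coe_nnreal]
        _ ≤ ENNReal.ofReal (h x / s) * (ENNReal.ofReal (s / h x) * A (h x)) := by gcongr
        _ = A (h x) := by
            rw [← mul_assoc, ← ENNReal.ofReal_mul (by positivity),
              div_mul_div_cancel₀ hspos.ne', div_self hhx.ne', ENNReal.ofReal_one, one_mul]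
  have hint : (∫⁻ x, ENNReal.ofReal (h x) ∂μ) * ENNReal.ofReal τ ≤ ∫⁻ x, A (h x) ∂μ + c := by
    rw [← lintegral_mul_const' _ _ ENNReal.ofReal_ne_top]
    refine (lintegral_mono hpt).trans ?_
    rw [lintegral_add_right _ measurable_const, lintegral_const, measure_univ, mul_one]
  have h3 : (c : ℝ≥0∞) + c ≤ ∫⁻ x, A (h x) ∂μ + c := by
    refine le_trans ?_ ((mul_le_mul_left hs (ENNReal.ofReal τ)).trans hint)
    rw [← ENNReal.ofReal_mul (by positivity), mul_assoc, hτs, ← ENNReal.ofReal_coe_nnreal,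
      ← ENNReal.ofReal_add c.coe_nonneg c.coe_nonneg]
    exact ENNReal.ofReal_le_ofReal (by linarith)
  exact (ENNReal.add_le_add_iff_right ENNReal.coe_ne_top).1 h3

end Young

section SphereEstimate

theorem lintegral_Ioo_swap {S h : ℝ → ℝ≥0∞} (hS : Measurable S) (hh : Measurable h) (b : ℝ) :
    ∫⁻ t in Ioo 0 b, S t * ∫⁻ s in Ioo 0 t, h s =
      ∫⁻ s in Ioo 0 b, h s * ∫⁻ t in Ioo s b, S t := by
  have hm : Measurable fun p : ℝ × ℝ =>
      {p : ℝ × ℝ | 0 < p.2 ∧ p.2 < p.1 ∧ p.1 < b}.indicator (fun p => S p.1 * h p.2) p := by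
    refine Measurable.indicator (by fun_prop) ?_
    exact (measurableSet_lt measurable_const measurable_snd).inter
      ((measurableSet_lt measurable_snd measurable_fst).inter
        (measurableSet_lt measurable_fst measurable_const))
  have hswap := lintegral_lintegral_swap (μ := (volume : Measure ℝ)) (ν := (volume : Measure ℝ))
    (f := fun t s => {p : ℝ × ℝ | 0 < p.2 ∧ p.2 < p.1 ∧ p.1 < b}.indicator
      (fun p => S p.1 * h p.2) (t, s)) hm.aemeasurable
  calc ∫⁻ t in Ioo 0 b, S t * ∫⁻ s in Ioo 0 t, h s
      = ∫⁻ t, ∫⁻ s, {p : ℝ × ℝ | 0 < p.2 ∧ p.2 < p.1 ∧ p.1 < b}.indicator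
        (fun p => S p.1 * h p.2) (t, s) := by
        rw [← lintegral_indicator measurableSet_Ioo]
        refine lintegral_congr fun t => ?_
        by_cases ht : t ∈ Ioo 0 b
        · rw [indicator_of_mem ht, ← lintegral_const_mul _ hh,
            ← lintegral_indicator measurableSet_Ioo]
          refine lintegral_congr fun s => ?_
          by_cases hs : s ∈ Ioo 0 t
          · rw [indicator_of_mem hs, indicator_of_mem]
            exact ⟨hs.1, hs.2, ht.2⟩
          · rw [indicator_of_notMem hs, indicator_of_notMem]
            exact fun h => hs ⟨h.1, h.2.1⟩
        · rw [indicator_of_notMem ht]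
          symm
          refine (lintegral_congr fun s => indicator_of_notMem ?_ _).trans lintegral_zero
          exact fun h => ht ⟨h.1.trans h.2.1, h.2.2⟩
    _ = ∫⁻ s in Ioo 0 b, h s * ∫⁻ t in Ioo s b, S t := by
        rw [hswap, ← lintegral_indicator measurableSet_Ioo]
        refine lintegral_congr fun s => ?_
        by_cases hs : s ∈ Ioo 0 b
        · rw [indicator_of_mem hs, ← lintegral_const_mul _ hS,
            ← lintegral_indicator measurableSet_Ioo]
          refine lintegral_congr fun t => ?_
          by_cases ht : t ∈ Ioo s b
          · rw [indicator_of_mem ht, indicator_of_mem, mul_comm]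
            exact ⟨hs.1, ht.1, ht.2⟩
          · rw [indicator_of_notMem ht, indicator_of_notMem]
            exact fun h => ht ⟨h.2.1, h.2.2⟩
        · rw [indicator_of_notMem hs]
          refine (lintegral_congr fun t => indicator_of_notMem ?_ _).trans lintegral_zero
          exact fun h => hs ⟨h.1, h.2.1.trans h.2.2⟩

theorem lintegral_sin_pow_le (k : ℕ) {s : ℝ} (hs : s ∈ Ioo 0 Real.pi) :
    ∫⁻ t in Ioo s Real.pi, ENNReal.ofReal (Real.sin t ^ k) ≤
      ENNReal.ofReal (Real.sin s ^ k) * ENNReal.ofReal (Real.pi ^ (k + 1) / s ^ k) := by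
  have hπ := Real.pi_pos
  have hs0 : 0 < s := hs.1
  have hconst : ∀ M : ℝ, 0 ≤ M → (∀ t ∈ Ioo s Real.pi, Real.sin t ^ k ≤ M) →
      ∫⁻ t in Ioo s Real.pi, ENNReal.ofReal (Real.sin t ^ k) ≤ ENNReal.ofReal (M * Real.pi) := by
    intro M hM h
    calc ∫⁻ t in Ioo s Real.pi, ENNReal.ofReal (Real.sin t ^ k)
        ≤ ∫⁻ t in Ioo s Real.pi, ENNReal.ofReal M :=
          setLIntegral_mono measurable_const fun t ht => ENNReal.ofReal_le_ofReal (h t ht)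
      _ = ENNReal.ofReal (M * (Real.pi - s)) := by
          rw [setLIntegral_const, Real.volume_Ioo, ENNReal.ofReal_mul hM]
      _ ≤ _ := ENNReal.ofReal_le_ofReal (mul_le_mul_of_nonneg_left (by linarith) hM)
  have hsin : 0 < Real.sin s := Real.sin_pos_of_pos_of_lt_pi hs.1 hs.2
  rw [← ENNReal.ofReal_mul (by positivity)]
  rcases le_total s (Real.pi / 2) with h1 | h1
  · refine (hconst 1 zero_le_one fun t ht => ?_).trans (ENNReal.ofReal_le_ofReal ?_)
    · exact pow_le_one₀ (Real.sin_pos_of_pos_of_lt_pi (hs0.trans ht.1) ht.2).le (Real.sin_le_one t)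
    · have h2 : 2 / Real.pi * s ≤ Real.sin s := Real.mul_le_sin hs0.le h1
      have h3 : 1 ≤ Real.sin s * Real.pi / s := by
        rw [le_div_iff₀ hs0, one_mul]
        have := mul_le_mul_of_nonneg_right h2 hπ.le
        have e : 2 / Real.pi * s * Real.pi = 2 * s := by field_simp
        nlinarith
      have h4 : Real.sin s ^ k * (Real.pi ^ (k + 1) / s ^ k) =
          (Real.sin s * Real.pi / s) ^ k * Real.pi := by
        rw [div_pow, mul_pow, pow_succ]; ring
      rw [h4]
      exact mul_le_mul_of_nonneg_right (one_le_pow₀ h3) hπ.le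
  · refine (hconst (Real.sin s ^ k) (by positivity) fun t ht => ?_).trans
      (ENNReal.ofReal_le_ofReal ?_)
    · have ht0 := (Real.sin_pos_of_pos_of_lt_pi (hs0.trans ht.1) ht.2).le
      refine pow_le_pow_left₀ ht0 ?_ k
      rw [← Real.sin_pi_sub t, ← Real.sin_pi_sub s]
      exact Real.sin_le_sin_of_le_of_le_pi_div_two (by linarith [ht.2]) (by linarith)
        (by linarith [ht.1])
    · refine mul_le_mul_of_nonneg_left ?_ (by positivity)
      rw [pow_succ, mul_div_right_comm]
      refine le_mul_of_one_le_left hπ.le ?_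
      rw [one_le_div (by positivity)]
      exact pow_le_pow_left₀ hs0.le hs.2.le k

theorem lintegral_Ioo_pow_comp {F : ℝ → ℝ≥0∞} (k : ℕ) (hk : 1 ≤ k) {z : ℝ} (hz : 0 < z) :
    ∫⁻ t in Ioo 0 Real.pi, ENNReal.ofReal (t ^ k) * F (z * Real.pi ^ k / t ^ k) =
      ENNReal.ofReal (Real.pi ^ (k + 1) / k) * (ENNReal.ofReal (z ^ (((k : ℝ) + 1) / k)) *
        ∫⁻ r in Ioi z, F r / ENNReal.ofReal (r ^ (1 + ((k : ℝ) + 1) / k))) := by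
  have hπ := Real.pi_pos
  set p : ℝ := ((k : ℝ) + 1) / k with hp
  have hk0 : (0 : ℝ) < k := by exact_mod_cast hk
  set c : ℝ := z * Real.pi ^ k with hc
  have hc0 : 0 < c := by positivity
  have himage : (fun t : ℝ => c / t ^ k) '' Ioo 0 Real.pi = Ioi z := by
    ext y
    constructor
    · rintro ⟨t, ht, rfl⟩
      have ht0 : 0 < t := ht.1
      change z < c / t ^ k
      rw [lt_div_iff₀ (by positivity), hc]
      exact mul_lt_mul_of_pos_left (pow_lt_pow_left₀ ht.2 ht0.le (by omega)) hz
    · intro hy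
      have hy0 : 0 < y := hz.trans hy
      have hpow : ((c / y) ^ ((k : ℝ)⁻¹)) ^ k = c / y :=
        Real.rpow_inv_natCast_pow (by positivity) (by omega)
      refine ⟨(c / y) ^ ((k : ℝ)⁻¹), ⟨by positivity, ?_⟩, ?_⟩
      · refine lt_of_pow_lt_pow_left₀ k hπ.le ?_
        rw [hpow, div_lt_iff₀ hy0, hc, mul_comm]
        exact mul_lt_mul_of_pos_left hy (by positivity)
      · simp only [hpow]
        field_simp
  have hderiv : ∀ t ∈ Ioo 0 Real.pi, HasDerivWithinAt (fun t : ℝ => c / t ^ k)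
      (-(c * k / t ^ (k + 1))) (Ioo 0 Real.pi) t := by
    intro t ht
    have ht0 : t ≠ 0 := ht.1.ne'
    have h := ((hasDerivAt_pow k t).inv (pow_ne_zero k ht0)).const_mul c
    have h' : HasDerivAt (fun t : ℝ => c / t ^ k) (c * (-(k * t ^ (k - 1)) / (t ^ k) ^ 2)) t := by
      simpa only [div_eq_mul_inv, Pi.inv_apply] using h
    have e : -(c * k / t ^ (k + 1)) = c * (-(k * t ^ (k - 1)) / (t ^ k) ^ 2) := by
      obtain ⟨j, hj⟩ : ∃ j, k = j + 1 := ⟨k - 1, by omega⟩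
      rw [hj, Nat.add_sub_cancel]
      field_simp
      ring
    rw [e]
    exact h'.hasDerivWithinAt
  have hinj : InjOn (fun t : ℝ => c / t ^ k) (Ioo 0 Real.pi) := by
    intro x hx y hy hxy
    have hx0 : 0 < x := hx.1
    have hy0 : 0 < y := hy.1
    have h : x ^ k = y ^ k := by
      have hxy' : c / x ^ k = c / y ^ k := hxy
      field_simp at hxy'
      exact hxy'.symm
    exact (pow_left_inj₀ hx0.le hy0.le (by omega)).1 h
  rw [← himage, lintegral_image_eq_lintegral_abs_deriv_mul measurableSet_Ioo hderiv hinj,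
    ← mul_assoc, ← ENNReal.ofReal_mul (by positivity), ← lintegral_const_mul' _ _ ENNReal.ofReal_ne_top]
  refine setLIntegral_congr_fun measurableSet_Ioo fun t ht => ?_
  have ht0 : 0 < t := ht.1
  rw [div_eq_mul_inv (F _), ← ENNReal.ofReal_inv_of_pos (by positivity), abs_neg,
    abs_of_pos (by positivity), mul_comm (F _), ← mul_assoc, ← mul_assoc,
    ← ENNReal.ofReal_mul (by positivity), ← ENNReal.ofReal_mul (by positivity)]
  congr 2
  have hpk : (k : ℝ) * p = k + 1 := by rw [hp]; field_simp
  have e1 : (t ^ k) ^ p = t ^ (k + 1) := by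
    rw [← Real.rpow_natCast, ← Real.rpow_mul ht0.le, hpk]
    exact_mod_cast Real.rpow_natCast t (k + 1)
  have e2 : (Real.pi ^ k) ^ p = Real.pi ^ (k + 1) := by
    rw [← Real.rpow_natCast, ← Real.rpow_mul hπ.le, hpk]
    exact_mod_cast Real.rpow_natCast Real.pi (k + 1)
  rw [Real.rpow_add (by positivity), Real.rpow_one, Real.div_rpow hc0.le (by positivity), e1, hc,
    Real.mul_rpow hz.le (by positivity), e2]
  have hzp : 0 < z ^ p := Real.rpow_pos_of_pos hz p
  field_simp

end SphereEstimate

section SphereOscillation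

variable {E : Type*} [NormedAddCommGroup E] [InnerProductSpace ℝ E]

theorem ofReal_abs_sub_le_lintegral_arc {w : E → ℝ} (hw : ContDiff ℝ 1 w) {a v : E}
    (ha : ‖a‖ = 1) (hv : ‖v‖ = 1) (hav : inner ℝ a v = 0) {t : ℝ} (ht : 0 ≤ t) :
    ENNReal.ofReal |w a - w (Real.cos t • a + Real.sin t • v)| ≤
      ∫⁻ s in Ioo 0 t, ENNReal.ofReal ‖fderiv ℝ w (Real.cos s • a + Real.sin s • v)‖ := by
  set γ : ℝ → E := fun s => Real.cos s • a + Real.sin s • v with hγ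
  set γ' : ℝ → E := fun s => -Real.sin s • a + Real.cos s • v with hγ'
  have hγd : ∀ s, HasDerivAt γ (γ' s) s := fun s =>
    ((Real.hasDerivAt_cos s).smul_const a).add ((Real.hasDerivAt_sin s).smul_const v)
  have hnorm : ∀ s, ‖γ' s‖ = 1 := by
    intro s
    have h : ‖γ' s‖ * ‖γ' s‖ = 1 := by
      rw [norm_add_mul_self_real, inner_smul_left, inner_smul_right, hav, norm_smul, norm_smul,
        ha, hv]
      simp only [norm_neg, Real.norm_eq_abs, mul_one, mul_zero, add_zero, abs_mul_abs_self]
      nlinarith [Real.sin_sq_add_cos_sq s]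
    nlinarith [norm_nonneg (γ' s)]
  have hcont : Continuous fun s => fderiv ℝ w (γ s) (γ' s) := by
    have h1 : Continuous (fderiv ℝ w) := hw.continuous_fderiv one_ne_zero
    have h2 : Continuous γ := by fun_prop
    have h3 : Continuous γ' := by fun_prop
    exact (h1.comp h2).clm_apply h3
  have hd : ∀ s, HasDerivAt (fun s => w (γ s)) (fderiv ℝ w (γ s) (γ' s)) s := fun s =>
    ((hw.differentiable one_ne_zero (γ s)).hasFDerivAt).comp_hasDerivAt s (hγd s)
  have hint := intervalIntegral.integral_eq_sub_of_hasDerivAt (a := 0) (b := t)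
    (fun s _ => hd s) (hcont.intervalIntegrable 0 t)
  have hγ0 : γ 0 = a := by simp [hγ]
  rw [hγ0, intervalIntegral.integral_of_le ht, integral_Ioc_eq_integral_Ioo] at hint
  have key := enorm_integral_le_lintegral_enorm (μ := volume.restrict (Ioo 0 t))
    fun s => fderiv ℝ w (γ s) (γ' s)
  rw [hint, ← ofReal_norm, Real.norm_eq_abs, abs_sub_comm] at key
  refine key.trans (lintegral_mono fun s => ?_)
  rw [← ofReal_norm]
  refine ENNReal.ofReal_le_ofReal ?_
  simpa [hnorm s] using (fderiv ℝ w (γ s)).le_opNorm (γ' s)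

variable [FiniteDimensional ℝ E] [MeasurableSpace E] [BorelSpace E]

theorem lintegral_sphere_abs_sub_le {k : ℕ} (hfin : Module.finrank ℝ E = k + 2) {w : E → ℝ}
    (hw : ContDiff ℝ 1 w) {a : E} (ha : ‖a‖ = 1) :
    ∫⁻ θ : sphere (0 : E) 1, ENNReal.ofReal |w a - w θ| ∂(volume : Measure E).toSphere ≤
      ∫⁻ v : sphere (0 : (ℝ ∙ a)ᗮ) 1, (∫⁻ t in Ioo 0 Real.pi,
        ENNReal.ofReal (Real.sin t ^ k) * (ENNReal.ofReal (Real.pi ^ (k + 1) / t ^ k) *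
          ENNReal.ofReal ‖fderiv ℝ w (Real.cos t • a + Real.sin t • ((v : (ℝ ∙ a)ᗮ) : E))‖))
        ∂(volume : Measure (ℝ ∙ a)ᗮ).toSphere := by
  have hwm : Measurable fun x => ENNReal.ofReal |w a - w x| := by
    have := hw.continuous.measurable
    fun_prop
  have hdw : Continuous (fderiv ℝ w) := hw.continuous_fderiv one_ne_zero
  rw [lintegral_sphere_eq_lintegral_axis (m := k + 1) (by omega) hfin ha hwm]
  refine lintegral_mono fun v => ?_
  rw [Nat.add_sub_cancel]
  have hv : ‖((v : (ℝ ∙ a)ᗮ) : E)‖ = 1 :=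
    norm_eq_of_mem_sphere v
  have hav : inner ℝ a ((v : (ℝ ∙ a)ᗮ) : E) = 0 :=
    Submodule.mem_orthogonal_singleton_iff_inner_right.1 (v : (ℝ ∙ a)ᗮ).2
  have hSm : Measurable fun t : ℝ => ENNReal.ofReal (Real.sin t ^ k) := by fun_prop
  have hhm : Measurable fun t : ℝ =>
      ENNReal.ofReal ‖fderiv ℝ w (Real.cos t • a + Real.sin t • ((v : (ℝ ∙ a)ᗮ) : E))‖ := by
    have : Continuous fun t : ℝ =>
      fderiv ℝ w (Real.cos t • a + Real.sin t • ((v : (ℝ ∙ a)ᗮ) : E)) := by fun_prop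
    exact (ENNReal.continuous_ofReal.comp this.norm).measurable
  calc _ ≤ ∫⁻ t in Ioo 0 Real.pi, ENNReal.ofReal (Real.sin t ^ k) * ∫⁻ s in Ioo 0 t,
          ENNReal.ofReal ‖fderiv ℝ w (Real.cos s • a + Real.sin s • ((v : (ℝ ∙ a)ᗮ) : E))‖ := by
        refine setLIntegral_mono' measurableSet_Ioo fun t ht => ?_
        gcongr
        exact ofReal_abs_sub_le_lintegral_arc hw ha hv hav ht.1.le
    _ = _ := lintegral_Ioo_swap hSm hhm Real.pi
    _ ≤ _ := by
        refine setLIntegral_mono' measurableSet_Ioo fun s hs => ?_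
        rw [← mul_assoc, mul_comm]
        gcongr
        exact lintegral_sin_pow_le k hs

theorem lintegral_sin_pow_ne (k : ℕ) :
    ∫⁻ t in Ioo 0 Real.pi, ENNReal.ofReal (Real.sin t ^ k) ≠ 0 ∧
      ∫⁻ t in Ioo 0 Real.pi, ENNReal.ofReal (Real.sin t ^ k) ≠ ∞ := by
  constructor
  · refine (setLIntegral_pos_iff (by fun_prop)).2 ?_ |>.ne'
    have : Function.support (fun t : ℝ => ENNReal.ofReal (Real.sin t ^ k)) ∩ Ioo 0 Real.pi =
        Ioo 0 Real.pi := by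
      refine inter_eq_right.2 fun t ht => ?_
      have := Real.sin_pos_of_pos_of_lt_pi ht.1 ht.2
      simp only [Function.mem_support, ne_eq, ENNReal.ofReal_eq_zero, not_le]
      positivity
    rw [this, Real.volume_Ioo]
    simpa using Real.pi_pos
  · refine ne_of_lt (lt_of_le_of_lt (setLIntegral_mono' (g := fun _ => 1) measurableSet_Ioo
      fun t ht => ?_) ?_)
    · rw [← ENNReal.ofReal_one]
      exact ENNReal.ofReal_le_ofReal (pow_le_one₀
        (Real.sin_pos_of_pos_of_lt_pi ht.1 ht.2).le (Real.sin_le_one t))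
    · simp

theorem toSphere_univ_eq_axis {k : ℕ} (hfin : Module.finrank ℝ E = k + 2) {a : E} (ha : ‖a‖ = 1) :
    (volume : Measure E).toSphere univ =
      (∫⁻ t in Ioo 0 Real.pi, ENNReal.ofReal (Real.sin t ^ k)) *
        (volume : Measure (ℝ ∙ a)ᗮ).toSphere univ := by
  have h := lintegral_sphere_eq_lintegral_axis (m := k + 1) (by omega) hfin ha
    (f := fun _ => (1 : ℝ≥0∞)) measurable_const
  simpa using h

theorem ofReal_mul_lintegral_sphere_abs_sub_le {k : ℕ} (hk : 1 ≤ k)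
    (hfin : Module.finrank ℝ E = k + 2) {A : ℝ → ℝ≥0∞} (hA : IsYoung A) {w : E → ℝ}
    (hw : ContDiff ℝ 1 w) {a : E} (ha : ‖a‖ = 1) {z : ℝ} (hz : 0 < z) :
    ENNReal.ofReal (z / Real.pi) *
        ∫⁻ θ : sphere (0 : E) 1, ENNReal.ofReal |w a - w θ| ∂(volume : Measure E).toSphere ≤
      ∫⁻ θ : sphere (0 : E) 1, A ‖fderiv ℝ w θ‖ ∂(volume : Measure E).toSphere +
        (volume : Measure (ℝ ∙ a)ᗮ).toSphere univ * (ENNReal.ofReal (Real.pi ^ (k + 1) / k) *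
          (ENNReal.ofReal (z ^ (((k : ℝ) + 1) / k)) *
            ∫⁻ r in Ioi z, youngConj A r / ENNReal.ofReal (r ^ (1 + ((k : ℝ) + 1) / k)))) := by
  have hπ := Real.pi_pos
  have hdw : Continuous (fderiv ℝ w) := hw.continuous_fderiv one_ne_zero
  have hAm : Measurable fun x => A ‖fderiv ℝ w x‖ :=
    hA.measurable_comp hdw.norm.measurable fun x => norm_nonneg _
  have hYm : Measurable (youngConj A) := (youngConj_mono A).measurable
  rw [lintegral_sphere_eq_lintegral_axis (m := k + 1) (by omega) hfin ha hAm,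
    ← lintegral_Ioo_pow_comp k hk hz, Nat.add_sub_cancel]
  calc _ ≤ ENNReal.ofReal (z / Real.pi) * _ := by
        gcongr
        exact lintegral_sphere_abs_sub_le hfin hw ha
    _ = ∫⁻ v : sphere (0 : (ℝ ∙ a)ᗮ) 1, ENNReal.ofReal (z / Real.pi) * (∫⁻ t in Ioo 0 Real.pi,
        ENNReal.ofReal (Real.sin t ^ k) * (ENNReal.ofReal (Real.pi ^ (k + 1) / t ^ k) *
          ENNReal.ofReal ‖fderiv ℝ w (Real.cos t • a + Real.sin t • ((v : (ℝ ∙ a)ᗮ) : E))‖))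
        ∂(volume : Measure (ℝ ∙ a)ᗮ).toSphere :=
        (lintegral_const_mul' _ _ ENNReal.ofReal_ne_top).symm
    _ ≤ ∫⁻ v : sphere (0 : (ℝ ∙ a)ᗮ) 1, ((∫⁻ t in Ioo 0 Real.pi,
        ENNReal.ofReal (Real.sin t ^ k) *
          A ‖fderiv ℝ w (Real.cos t • a + Real.sin t • ((v : (ℝ ∙ a)ᗮ) : E))‖) +
        ∫⁻ t in Ioo 0 Real.pi,
          ENNReal.ofReal (t ^ k) * youngConj A (z * Real.pi ^ k / t ^ k))
        ∂(volume : Measure (ℝ ∙ a)ᗮ).toSphere := by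
        refine lintegral_mono fun v => ?_
        rw [← lintegral_const_mul' _ _ ENNReal.ofReal_ne_top, ← lintegral_add_right _ (by fun_prop)]
        refine setLIntegral_mono' measurableSet_Ioo fun t ht => ?_
        have ht0 : 0 < t := ht.1
        have hs := Real.sin_pos_of_pos_of_lt_pi ht.1 ht.2
        set H := ‖fderiv ℝ w (Real.cos t • a + Real.sin t • ((v : (ℝ ∙ a)ᗮ) : E))‖ with hH
        have h1 := young_inequality A (norm_nonneg _ : 0 ≤ H) (z * Real.pi ^ k / t ^ k)
        have h2 : ENNReal.ofReal (z / Real.pi) *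
            (ENNReal.ofReal (Real.sin t ^ k) * (ENNReal.ofReal (Real.pi ^ (k + 1) / t ^ k) *
              ENNReal.ofReal H)) =
            ENNReal.ofReal (Real.sin t ^ k) *
              ENNReal.ofReal (H * (z * Real.pi ^ k / t ^ k)) := by
          rw [mul_left_comm, ← ENNReal.ofReal_mul (by positivity),
            ← ENNReal.ofReal_mul (by positivity)]
          congr 2
          field_simp
          ring
        rw [h2]
        calc _ ≤ ENNReal.ofReal (Real.sin t ^ k) *
              (A H + youngConj A (z * Real.pi ^ k / t ^ k)) := by gcongr
          _ ≤ _ := by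
            rw [mul_add]
            gcongr
            exact Real.sin_le ht0.le
    _ = _ := by
        rw [lintegral_add_right _ measurable_const, lintegral_const, mul_comm (lintegral _ _)]

theorem ofReal_mul_toSphere_univ_le (w : E → ℝ) (hw : ContDiff ℝ 1 w) (a b : E) :
    ENNReal.ofReal |w a - w b| * (volume : Measure E).toSphere univ ≤
      ∫⁻ θ : sphere (0 : E) 1, ENNReal.ofReal |w a - w θ| ∂(volume : Measure E).toSphere +
        ∫⁻ θ : sphere (0 : E) 1, ENNReal.ofReal |w b - w θ| ∂(volume : Measure E).toSphere := by
  have := hw.continuous.measurable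
  rw [← lintegral_add_right _ (by fun_prop), ← lintegral_const]
  refine lintegral_mono fun θ => ?_
  rw [← ENNReal.ofReal_add (abs_nonneg _) (abs_nonneg _), abs_sub_comm (w b)]
  exact ENNReal.ofReal_le_ofReal (abs_sub_le _ _ _)

theorem exists_young_le_lintegral_sphere (hfin : Module.finrank ℝ E = 2) :
    ∃ C : ℝ, 0 < C ∧ ∀ A : ℝ → ℝ≥0∞, IsYoung A → ∀ w : E → ℝ, ContDiff ℝ 1 w →
      ∀ a b : E, ‖a‖ = 1 → ‖b‖ = 1 → A (|w a - w b| / C) ≤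
        ENNReal.ofReal C *
          ∫⁻ θ : sphere (0 : E) 1, A ‖fderiv ℝ w θ‖ ∂(volume : Measure E).toSphere := by
  have hπ := Real.pi_pos
  have : Nontrivial E := Module.nontrivial_of_finrank_pos (R := ℝ) (by omega)
  set S : Measure (sphere (0 : E) 1) := (volume : Measure E).toSphere with hS
  have hS0 : S univ ≠ 0 := by
    rw [Ne, Measure.measure_univ_eq_zero]
    exact Measure.toSphere_ne_zero _
  have hSt : S univ ≠ ∞ := measure_ne_top _ _
  set s := (S univ).toReal with hs
  have hs0 : 0 < s := ENNReal.toReal_pos hS0 hSt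
  have hsS : S univ = ENNReal.ofReal s := (ENNReal.ofReal_toReal hSt).symm
  refine ⟨4 * Real.pi + 1 / s, by positivity, fun A hA w hw a b ha hb => ?_⟩
  have hdw : Continuous (fderiv ℝ w) := hw.continuous_fderiv one_ne_zero
  have hbound : ∀ {a : E}, ‖a‖ = 1 → ∫⁻ θ : sphere (0 : E) 1, ENNReal.ofReal |w a - w θ| ∂S ≤
      ENNReal.ofReal Real.pi * ∫⁻ θ : sphere (0 : E) 1, ENNReal.ofReal ‖fderiv ℝ w θ‖ ∂S := by
    intro a ha
    have hm : Measurable fun x => ENNReal.ofReal Real.pi * ENNReal.ofReal ‖fderiv ℝ w x‖ := by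
      have := hdw.norm.measurable
      fun_prop
    have h1 := lintegral_sphere_abs_sub_le (k := 0) hfin hw ha
    have h2 := lintegral_sphere_eq_lintegral_axis (m := 1) le_rfl hfin ha hm
    rw [lintegral_const_mul' _ _ ENNReal.ofReal_ne_top] at h2
    rw [h2]
    simpa using h1
  have hosc := (ofReal_mul_toSphere_univ_le w hw a b).trans (add_le_add (hbound ha) (hbound hb))
  rw [← two_mul, ← hS, hsS] at hosc
  have hprob : IsProbabilityMeasure ((S univ)⁻¹ • S) :=
    ⟨by rw [Measure.smul_apply, smul_eq_mul, ENNReal.inv_mul_cancel hS0 hSt]⟩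
  have hJ := hA.le_lintegral (μ := (S univ)⁻¹ • S) (h := fun θ : sphere (0 : E) 1 => ‖fderiv ℝ w θ‖)
    (fun _ => norm_nonneg _) (s := |w a - w b| / (4 * Real.pi)) ?_ (by positivity)
  · rw [lintegral_smul_measure, smul_eq_mul] at hJ
    calc _ ≤ A (|w a - w b| / (4 * Real.pi)) := by
          refine hA.mono (by positivity) ?_
          gcongr
          exact le_add_of_nonneg_right (by positivity)
      _ ≤ _ := hJ
      _ ≤ _ := by
          gcongr
          rw [hsS, ← ENNReal.ofReal_inv_of_pos hs0, ← one_div]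
          exact ENNReal.ofReal_le_ofReal (le_add_of_nonneg_left (by positivity))
  · rw [lintegral_smul_measure, smul_eq_mul, hsS, ← ENNReal.ofReal_inv_of_pos hs0]
    have h3 : ENNReal.ofReal (2 * (|w a - w b| / (4 * Real.pi))) =
        ENNReal.ofReal (s⁻¹ / (2 * Real.pi)) *
          (ENNReal.ofReal |w a - w b| * ENNReal.ofReal s) := by
      rw [← ENNReal.ofReal_mul (by positivity), ← ENNReal.ofReal_mul (by positivity)]
      congr 1
      field_simp
      ring
    have h4 : ENNReal.ofReal (s⁻¹ / (2 * Real.pi)) * (2 * (ENNReal.ofReal Real.pi)) =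
        ENNReal.ofReal s⁻¹ := by
      rw [show (2 : ℝ≥0∞) = ENNReal.ofReal 2 by simp, ← ENNReal.ofReal_mul (by positivity),
        ← ENNReal.ofReal_mul (by positivity)]
      congr 1
      field_simp
    rw [h3, ← h4, mul_assoc, mul_assoc]
    gcongr

theorem exists_youngConj_le_lintegral_sphere {k : ℕ} (hk : 1 ≤ k)
    (hfin : Module.finrank ℝ E = k + 2) :
    ∃ C : ℝ, 0 < C ∧ ∀ A : ℝ → ℝ≥0∞, IsYoung A → ∀ w : E → ℝ, ContDiff ℝ 1 w →
      ∀ a b : E, ‖a‖ = 1 → ‖b‖ = 1 →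
      youngConj (fun t => ENNReal.ofReal (t ^ (((k : ℝ) + 1) / k)) *
        ∫⁻ r in Ioi t, youngConj A r / ENNReal.ofReal (r ^ (1 + ((k : ℝ) + 1) / k)))
          (|w a - w b| / C) ≤
        ENNReal.ofReal C *
          ∫⁻ θ : sphere (0 : E) 1, A ‖fderiv ℝ w θ‖ ∂(volume : Measure E).toSphere := by
  have hπ := Real.pi_pos
  have hk0 : (0 : ℝ) < k := by exact_mod_cast hk
  have : Nontrivial E := Module.nontrivial_of_finrank_pos (R := ℝ) (by omega)
  set S : Measure (sphere (0 : E) 1) := (volume : Measure E).toSphere with hS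
  have hS0 : S univ ≠ 0 := by
    rw [Ne, Measure.measure_univ_eq_zero]
    exact Measure.toSphere_ne_zero _
  have hSt : S univ ≠ ∞ := measure_ne_top _ _
  obtain ⟨hJ0, hJt⟩ := lintegral_sin_pow_ne k
  set J := ∫⁻ t in Ioo 0 Real.pi, ENNReal.ofReal (Real.sin t ^ k) with hJ
  set s := (S univ).toReal with hs
  have hs0 : 0 < s := ENNReal.toReal_pos hS0 hSt
  have hsS : S univ = ENNReal.ofReal s := (ENNReal.ofReal_toReal hSt).symm
  set ω : ℝ := (S univ / J).toReal with hω
  have hωt : S univ / J ≠ ∞ := ENNReal.div_ne_top hSt hJ0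
  have hω0 : 0 < ω := ENNReal.toReal_pos (ENNReal.div_ne_zero.2 ⟨hS0, hJt⟩) hωt
  have haxis : ∀ {a : E}, ‖a‖ = 1 →
      (volume : Measure (ℝ ∙ a)ᗮ).toSphere univ = ENNReal.ofReal ω := by
    intro a ha
    rw [hω, ENNReal.ofReal_toReal hωt, ENNReal.eq_div_iff hJ0 hJt]
    exact (toSphere_univ_eq_axis hfin ha).symm
  set c : ℝ := Real.pi ^ (k + 1) / k with hc
  have hc0 : 0 < c := by positivity
  set C : ℝ := 2 * Real.pi * ω * c / s + 1 / (ω * c) with hC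
  have hC0 : 0 < C := by positivity
  refine ⟨C, hC0, fun A hA w hw a b ha hb => iSup_le fun z => tsub_le_iff_left.2 ?_⟩
  obtain ⟨z, hz⟩ := z
  rcases (mem_Ici.1 hz).eq_or_lt with rfl | hz0
  · simp
  set I := ∫⁻ θ : sphere (0 : E) 1, A ‖fderiv ℝ w θ‖ ∂S with hI
  set T := ENNReal.ofReal (z ^ (((k : ℝ) + 1) / k)) *
        ∫⁻ r in Ioi z, youngConj A r / ENNReal.ofReal (r ^ (1 + ((k : ℝ) + 1) / k)) with hT
  have h1 := ofReal_mul_lintegral_sphere_abs_sub_le hk hfin hA hw ha hz0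
  have h2 := ofReal_mul_lintegral_sphere_abs_sub_le hk hfin hA hw hb hz0
  rw [haxis ha] at h1
  rw [haxis hb] at h2
  have h3 := add_le_add h1 h2
  rw [← mul_add, ← two_mul] at h3
  have h4 : ENNReal.ofReal (z / Real.pi) * (ENNReal.ofReal |w a - w b| * S univ) ≤
      2 * (I + ENNReal.ofReal ω * (ENNReal.ofReal c * T)) := by
    refine le_trans ?_ h3
    gcongr
    exact ofReal_mul_toSphere_univ_le w hw a b
  have hne : ENNReal.ofReal (2 * (ω * c)) ≠ 0 := by
    rw [Ne, ENNReal.ofReal_eq_zero, not_le]; positivity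
  change ENNReal.ofReal (z * (|w a - w b| / C)) ≤ T + ENNReal.ofReal C * I
  refine (ENNReal.mul_le_mul_iff_right hne ENNReal.ofReal_ne_top).1 ?_
  calc ENNReal.ofReal (2 * (ω * c)) * ENNReal.ofReal (z * (|w a - w b| / C))
      ≤ ENNReal.ofReal (z / Real.pi) * (ENNReal.ofReal |w a - w b| * S univ) := by
        rw [hsS, ← ENNReal.ofReal_mul (by positivity), ← ENNReal.ofReal_mul (by positivity),
          ← ENNReal.ofReal_mul (by positivity)]
        refine ENNReal.ofReal_le_ofReal ?_
        have hCs : 2 * Real.pi * ω * c ≤ C * s := by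
          rw [hC, add_mul, div_mul_cancel₀ _ hs0.ne']
          exact le_add_of_nonneg_right (by positivity)
        have e1 : 2 * (ω * c) * (z * (|w a - w b| / C)) =
            (2 * Real.pi * ω * c) * (z * |w a - w b| / (Real.pi * C)) := by
          field_simp
        have e2 : z / Real.pi * (|w a - w b| * s) =
            (C * s) * (z * |w a - w b| / (Real.pi * C)) := by
          field_simp
        rw [e1, e2]
        gcongr
    _ ≤ _ := h4
    _ ≤ _ := by
        rw [mul_add, mul_add, add_comm]
        have e : ENNReal.ofReal (2 * (ω * c)) = 2 * (ENNReal.ofReal ω * ENNReal.ofReal c) := by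
          rw [ENNReal.ofReal_mul zero_le_two, ENNReal.ofReal_mul hω0.le, ENNReal.ofReal_ofNat]
        refine add_le_add (le_of_eq ?_) ?_
        · rw [e]; ring
        · rw [← mul_assoc]
          gcongr
          rw [← ENNReal.ofReal_mul (by positivity), ← ENNReal.ofReal_ofNat]
          refine ENNReal.ofReal_le_ofReal ?_
          have : 1 ≤ ω * c * C := by
            rw [hC, mul_add, mul_one_div_cancel (by positivity)]
            exact le_add_of_nonneg_left (by positivity)
          linarith

end SphereOscillation

theorem exists_youngShifted_le_lintegral_sphere {n : ℕ} (hn : 2 ≤ n) :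
    ∃ C : ℝ, 0 < C ∧ ∀ A : ℝ → ℝ≥0∞, IsYoung A → ∀ w : Euc n → ℝ, ContDiff ℝ 1 w →
      ∀ a b : Euc n, ‖a‖ = 1 → ‖b‖ = 1 → youngShifted n A (|w a - w b| / C) ≤
        ENNReal.ofReal C *
          ∫⁻ θ : sphere (0 : Euc n) 1, A ‖fderiv ℝ w θ‖ ∂(volume : Measure (Euc n)).toSphere := by
  rcases hn.eq_or_lt with rfl | hn2
  · simpa [youngShifted] using exists_young_le_lintegral_sphere (E := Euc 2) (by simp)
  · obtain ⟨k, rfl⟩ : ∃ k, n = k + 2 := ⟨n - 2, by omega⟩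
    have hexp : youngExp (k + 2) = ((k : ℝ) + 1) / k := by
      rw [youngExp]
      push_cast
      congr 1 <;> ring
    have h := exists_youngConj_le_lintegral_sphere (E := Euc (k + 2)) (k := k) (by omega) (by simp)
    simpa only [youngShifted, hexp, if_neg (show k + 2 ≠ 2 by omega)] using h

section Mollification

/-- A generalized dominated convergence theorem, with a convergent sequence of majorants. -/
theorem tendsto_lintegral_zero_of_le_of_tendsto {α : Type*} [MeasurableSpace α] {μ : Measure α}
    {X D : ℕ → α → ℝ≥0∞} {D₀ : α → ℝ≥0∞} (hX : ∀ k, AEMeasurable (X k) μ)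
    (hD : ∀ k, AEMeasurable (D k) μ) (hD₀ : AEMeasurable D₀ μ) (hfin : ∫⁻ x, D₀ x ∂μ ≠ ∞)
    (hle : ∀ k, ∀ᵐ x ∂μ, X k x ≤ D k x)
    (hX0 : ∀ᵐ x ∂μ, Tendsto (fun k => X k x) atTop (𝓝 0))
    (hDt : ∀ᵐ x ∂μ, Tendsto (fun k => D k x) atTop (𝓝 (D₀ x)))
    (hint : Tendsto (fun k => ∫⁻ x, D k x ∂μ) atTop (𝓝 (∫⁻ x, D₀ x ∂μ))) :
    Tendsto (fun k => ∫⁻ x, X k x ∂μ) atTop (𝓝 0) := by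
  have h1 : Tendsto (fun k => ∫⁻ x, min (X k x) (D₀ x) ∂μ) atTop (𝓝 (∫⁻ _, 0 ∂μ)) := by
    refine tendsto_lintegral_of_dominated_convergence' D₀ (fun k => (hX k).min hD₀)
      (fun k => Eventually.of_forall fun x => min_le_right _ _) hfin ?_
    filter_upwards [hX0] with x hx
    simpa using hx.min (tendsto_const_nhds (x := D₀ x))
  have h2 : Tendsto (fun k => ∫⁻ x, min (D k x) (D₀ x) ∂μ) atTop (𝓝 (∫⁻ x, D₀ x ∂μ)) := by
    refine tendsto_lintegral_of_dominated_convergence' D₀ (fun k => (hD k).min hD₀)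
      (fun k => Eventually.of_forall fun x => min_le_right _ _) hfin ?_
    filter_upwards [hDt] with x hx
    simpa using hx.min (tendsto_const_nhds (x := D₀ x))
  have h3 : Tendsto (fun k => ∫⁻ x, D k x ∂μ - ∫⁻ x, min (D k x) (D₀ x) ∂μ) atTop (𝓝 0) := by
    simpa using ENNReal.Tendsto.sub hint h2 (Or.inl hfin)
  have h4 := h1.add h3
  rw [lintegral_zero, add_zero] at h4
  refine tendsto_of_tendsto_of_tendsto_of_le_of_le tendsto_const_nhds h4 (fun k => zero_le) ?_
  intro k
  have hne : ∫⁻ x, min (D k x) (D₀ x) ∂μ ≠ ∞ :=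
    ne_top_of_le_ne_top hfin (lintegral_mono fun x => min_le_right _ _)
  dsimp only
  rw [← lintegral_sub' ((hD k).min hD₀) hne
    (Eventually.of_forall fun x => min_le_left _ _),
    ← lintegral_add_left' ((hX k).min hD₀)]
  refine lintegral_mono_ae ?_
  filter_upwards [hle k] with x hx
  rcases le_total (X k x) (D₀ x) with h | h
  · rw [min_eq_left h]; exact le_self_add
  · rw [min_eq_right h, min_eq_right (h.trans hx), add_tsub_cancel_of_le (h.trans hx)]
    exact hx

variable {G : Type*} [NormedAddCommGroup G] [NormedSpace ℝ G] [FiniteDimensional ℝ G]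
  [MeasurableSpace G] [BorelSpace G] {μ : Measure G} [μ.IsAddHaarMeasure]

open scoped Convolution in
theorem tendsto_lintegral_convolution_sub {V : Type*} [NormedAddCommGroup V] [NormedSpace ℝ V]
    [CompleteSpace V] {f : G → V} (hf : Integrable f μ) {φ : ℕ → ContDiffBump (0 : G)}
    (hφ : Tendsto (fun k => (φ k).rOut) atTop (𝓝 0)) {K : ℝ}
    (hK : ∀ᶠ k in atTop, (φ k).rOut ≤ K * (φ k).rIn) :
    Tendsto (fun k => ∫⁻ x, ‖((φ k).normed μ ⋆[ContinuousLinearMap.lsmul ℝ ℝ, μ] f) x - f x‖ₑ ∂μ)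
      atTop (𝓝 0) := by
  have hc : ∀ k, Integrable ((φ k).normed μ ⋆[ContinuousLinearMap.lsmul ℝ ℝ, μ] f) μ := fun k =>
    ((φ k).integrable_normed).integrable_convolution _ hf
  have hcn : ∀ k, Integrable
      ((φ k).normed μ ⋆[ContinuousLinearMap.lsmul ℝ ℝ, μ] fun x => ‖f x‖) μ := fun k =>
    ((φ k).integrable_normed).integrable_convolution _ hf.norm
  have hn0 : ∀ k x, 0 ≤ ((φ k).normed μ ⋆[ContinuousLinearMap.lsmul ℝ ℝ, μ] fun x => ‖f x‖) x := by
    intro k x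
    rw [convolution_lsmul]
    exact integral_nonneg fun t => smul_nonneg ((φ k).nonneg_normed t) (norm_nonneg _)
  refine tendsto_lintegral_zero_of_le_of_tendsto
    (D := fun k x => ENNReal.ofReal
      (((φ k).normed μ ⋆[ContinuousLinearMap.lsmul ℝ ℝ, μ] fun x => ‖f x‖) x) + ‖f x‖ₑ)
    (D₀ := fun x => ‖f x‖ₑ + ‖f x‖ₑ) (fun k => ((hc k).sub hf).aestronglyMeasurable.enorm)
    (fun k => (hcn k).aemeasurable.ennreal_ofReal.add hf.aestronglyMeasurable.enorm)
    (hf.aestronglyMeasurable.enorm.add hf.aestronglyMeasurable.enorm) ?_ ?_ ?_ ?_ ?_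
  · rw [lintegral_add_left' hf.aestronglyMeasurable.enorm]
    exact ENNReal.add_ne_top.2 ⟨hf.2.ne, hf.2.ne⟩
  · intro k
    refine Eventually.of_forall fun x => (enorm_sub_le).trans ?_
    gcongr
    rw [← ofReal_norm]
    refine ENNReal.ofReal_le_ofReal ?_
    rw [convolution_lsmul, convolution_lsmul]
    refine (norm_integral_le_integral_norm _).trans (le_of_eq ?_)
    refine integral_congr_ae (Eventually.of_forall fun t => ?_)
    simp only [norm_smul, smul_eq_mul, Real.norm_eq_abs, abs_of_nonneg ((φ k).nonneg_normed t)]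
  · filter_upwards [ContDiffBump.ae_convolution_tendsto_right_of_locallyIntegrable hφ hK
      hf.locallyIntegrable] with x hx
    simpa using (hx.sub_const (f x)).enorm
  · filter_upwards [ContDiffBump.ae_convolution_tendsto_right_of_locallyIntegrable hφ hK
      hf.norm.locallyIntegrable] with x hx
    rw [← ofReal_norm]
    exact (ENNReal.tendsto_ofReal hx).add tendsto_const_nhds
  · refine tendsto_const_nhds.congr fun k => ?_
    rw [lintegral_add_left' hf.aestronglyMeasurable.enorm,
      lintegral_add_left' (hcn k).aemeasurable.ennreal_ofReal,
      ← ofReal_integral_eq_lintegral_ofReal (hcn k) (Eventually.of_forall (hn0 k)),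
      integral_convolution _ (φ k).integrable_normed hf.norm, (φ k).integral_normed]
    simp [ofReal_integral_norm_eq_lintegral_enorm hf]

end Mollification

section WeakGradient

theorem LocallyIntegrableOn.integrable_mul_of_tsupport {X : Type*} [TopologicalSpace X]
    [MeasurableSpace X] [OpensMeasurableSpace X] [T2Space X] {μ : Measure X} {Ω : Set X}
    {f ψ : X → ℝ} (hf : LocallyIntegrableOn f Ω μ) (hψ : Continuous ψ) (hc : HasCompactSupport ψ)
    (hΩ : tsupport ψ ⊆ Ω) : Integrable (fun x => f x * ψ x) μ := by
  have h : IntegrableOn (fun x => f x * ψ x) (tsupport ψ) μ :=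
    (hf.integrableOn_compact_subset hΩ hc).mul_continuousOn hψ.continuousOn hc
  refine (integrableOn_iff_integrable_of_support_subset fun x hx => ?_).1 h
  exact subset_tsupport _ (right_ne_zero_of_mul hx)

variable {n : ℕ} {Ω : Set (Euc n)} {u : Euc n → ℝ} {g : Euc n → Euc n}

theorem exists_measurable_partial (hΩ : IsOpen Ω) (h : IsWeakGradOn Ω u g) (i : Fin n) :
    ∃ p : Euc n → ℝ, Measurable p ∧ LocallyIntegrableOn p Ω volume ∧
      (∀ φ : Euc n → ℝ, ContDiff ℝ (⊤ : ℕ∞) φ → HasCompactSupport φ → tsupport φ ⊆ Ω →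
        ∫ x, u x * fderiv ℝ φ x (EuclideanSpace.single i 1) = - ∫ x, p x * φ x) ∧
      ∀ᵐ x ∂volume.restrict Ω, ‖p x‖ ≤ ‖g x i‖ := by
  obtain ⟨hu, -, hw⟩ := h
  by_cases hint : ∀ φ : Euc n → ℝ, ContDiff ℝ (⊤ : ℕ∞) φ → HasCompactSupport φ → tsupport φ ⊆ Ω →
      Integrable (fun x => g x i * φ x) volume
  · have hloc : LocallyIntegrableOn (fun x => g x i) Ω volume := by
      intro x hx
      obtain ⟨r, hr, hrΩ⟩ := nhds_basis_closedBall.mem_iff.1 (hΩ.mem_nhds hx)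
      let φ : ContDiffBump x := ⟨r / 2, r, by positivity, by linarith⟩
      have hi := hint φ φ.contDiff φ.hasCompactSupport (by rw [φ.tsupport_eq]; exact hrΩ)
      refine ⟨closedBall x (r / 2),
        mem_nhdsWithin_of_mem_nhds (closedBall_mem_nhds x (by positivity)), ?_⟩
      refine hi.integrableOn.congr_fun (fun y hy => ?_) measurableSet_closedBall
      simp [φ.one_of_mem_closedBall hy]
    have hm := hloc.aestronglyMeasurable.aemeasurable
    have hae : (fun x => g x i) =ᵐ[volume.restrict Ω] hm.mk _ := hm.ae_eq_mk
    refine ⟨hm.mk _, hm.measurable_mk, hloc.congr hae, fun φ h1 h2 h3 => ?_, ?_⟩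
    · rw [hw φ h1 h2 h3 i]
      congr 1
      refine integral_congr_ae ?_
      rw [Filter.EventuallyEq, ae_restrict_iff' hΩ.measurableSet] at hae
      filter_upwards [hae] with x hx
      by_cases hxΩ : x ∈ Ω
      · rw [hx hxΩ]
      · rw [image_eq_zero_of_notMem_tsupport fun hx => hxΩ (h3 hx), mul_zero, mul_zero]
    · filter_upwards [hae] with x hx
      exact le_of_eq (by rw [← hx])
  · push Not at hint
    obtain ⟨φ₀, h1, h2, h3, h4⟩ := hint
    refine ⟨0, measurable_zero, locallyIntegrableOn_zero, fun φ k1 k2 k3 => ?_,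
      Eventually.of_forall fun x => by simp⟩
    simp only [Pi.zero_apply, zero_mul, integral_zero, neg_zero]
    rw [hw φ k1 k2 k3 i]
    by_cases hφ : Integrable (fun x => g x i * φ x) volume
    · have hadd : ¬ Integrable (fun x => g x i * (φ₀ + φ) x) volume := fun hi => h4 <| by
        refine (hi.sub hφ).congr (Eventually.of_forall fun x => ?_)
        simp only [Pi.sub_apply, Pi.add_apply]
        ring
      have hts : tsupport (φ₀ + φ) ⊆ Ω := (tsupport_add φ₀ φ).trans (union_subset h3 k3)
      have e1 := hw (φ₀ + φ) (h1.add k1) (h2.add k2) hts i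
      have e2 := hw φ₀ h1 h2 h3 i
      rw [integral_undef hadd] at e1
      rw [integral_undef h4] at e2
      have hd : ∀ {φ : Euc n → ℝ}, ContDiff ℝ (⊤ : ℕ∞) φ → HasCompactSupport φ → tsupport φ ⊆ Ω →
          Integrable (fun x => u x * fderiv ℝ φ x (EuclideanSpace.single i 1)) volume := by
        intro φ l1 l2 l3
        refine LocallyIntegrableOn.integrable_mul_of_tsupport hu ?_ (l2.fderiv_apply ℝ _)
          ((tsupport_fderiv_apply_subset ℝ _).trans l3)
        exact (l1.continuous_fderiv (by simp)).clm_apply continuous_const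
      have e3 : ∫ x, u x * fderiv ℝ (φ₀ + φ) x (EuclideanSpace.single i 1) =
          (∫ x, u x * fderiv ℝ φ₀ x (EuclideanSpace.single i 1)) +
            ∫ x, u x * fderiv ℝ φ x (EuclideanSpace.single i 1) := by
        rw [← integral_add (hd h1 h2 h3) (hd k1 k2 k3)]
        refine integral_congr_ae (Eventually.of_forall fun x => ?_)
        dsimp only
        rw [fderiv_add (h1.differentiable (by simp) x) (k1.differentiable (by simp) x),
          add_apply, mul_add]
      rw [← hw φ k1 k2 k3 i]
      linarith
    · rw [integral_undef hφ, neg_zero]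

theorem exists_measurable_weakGrad (hΩ : IsOpen Ω) (h : IsWeakGradOn Ω u g) :
    ∃ p : Euc n → Euc n, Measurable p ∧ (∀ i, LocallyIntegrableOn (fun x => p x i) Ω volume) ∧
      (∀ φ : Euc n → ℝ, ContDiff ℝ (⊤ : ℕ∞) φ → HasCompactSupport φ → tsupport φ ⊆ Ω →
        ∀ i : Fin n, ∫ x, u x * fderiv ℝ φ x (EuclideanSpace.single i 1) = - ∫ x, p x i * φ x) ∧
      ∀ᵐ x ∂volume.restrict Ω, ‖p x‖ ≤ ‖g x‖ := by
  choose p hm hloc hw hle using exists_measurable_partial hΩ h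
  refine ⟨fun x => WithLp.toLp 2 fun i => p i x, by fun_prop, hloc,
    fun φ h1 h2 h3 i => hw i φ h1 h2 h3, ?_⟩
  filter_upwards [ae_all_iff.2 hle] with x hx
  rw [EuclideanSpace.norm_eq, EuclideanSpace.norm_eq]
  refine Real.sqrt_le_sqrt (Finset.sum_le_sum fun i _ => ?_)
  exact pow_le_pow_left₀ (norm_nonneg _) (hx i) 2

end WeakGradient

section SmoothApproximation

variable {n : ℕ} {Ω : Set (Euc n)} {u : Euc n → ℝ} {p : Euc n → Euc n}

theorem norm_gradient_eq_norm_fderiv (w : Euc n → ℝ) (x : Euc n) :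
    ‖gradient w x‖ = ‖fderiv ℝ w x‖ :=
  (InnerProductSpace.toDual ℝ (Euc n)).symm.norm_map _

open scoped Convolution in
theorem gradient_convolution_eq
    (hw : ∀ φ : Euc n → ℝ, ContDiff ℝ (⊤ : ℕ∞) φ → HasCompactSupport φ → tsupport φ ⊆ Ω →
      ∀ i : Fin n, ∫ x, u x * fderiv ℝ φ x (EuclideanSpace.single i 1) = - ∫ x, p x i * φ x)
    {K : Set (Euc n)} (hKΩ : K ⊆ Ω) (hU : Integrable (K.indicator u))
    (hP : Integrable (K.indicator p)) {η : Euc n → ℝ} (hη : ContDiff ℝ (⊤ : ℕ∞) η)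
    (hηc : HasCompactSupport η) {x : Euc n} (hx : tsupport (fun y => η (x - y)) ⊆ K) :
    gradient (η ⋆[ContinuousLinearMap.lsmul ℝ ℝ, volume] K.indicator u) x =
      (η ⋆[ContinuousLinearMap.lsmul ℝ ℝ, volume] K.indicator p) x := by
  have hη1 : ContDiff ℝ 1 η := hη.of_le (by exact_mod_cast le_top)
  have hfd := hηc.hasFDerivAt_convolution_left (ContinuousLinearMap.lsmul ℝ ℝ) hη1
    hU.locallyIntegrable x
  have hex : ConvolutionExistsAt (fderiv ℝ η) (K.indicator u) x
      ((ContinuousLinearMap.lsmul ℝ ℝ).precompL (Euc n)) volume :=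
    (hηc.fderiv ℝ).convolutionExists_left _ (hη1.continuous_fderiv one_ne_zero)
      hU.locallyIntegrable x
  have hexp : ConvolutionExistsAt η (K.indicator p) x (ContinuousLinearMap.lsmul ℝ ℝ) volume :=
    hηc.convolutionExists_left _ hη.continuous hP.locallyIntegrable x
  have hφ : ContDiff ℝ (⊤ : ℕ∞) fun y => η (x - y) := hη.comp (contDiff_const.sub contDiff_id)
  have hφc : HasCompactSupport fun y => η (x - y) := hηc.comp_homeomorph (Homeomorph.subLeft x)
  have hφd : ∀ y, fderiv ℝ (fun y => η (x - y)) y = - fderiv ℝ η (x - y) := by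
    intro y
    have h1 : HasFDerivAt (fun y : Euc n => x - y) (-ContinuousLinearMap.id ℝ (Euc n)) y := by
      simpa using (hasFDerivAt_id (𝕜 := ℝ) y).const_sub x
    have h2 := (hη1.differentiable one_ne_zero (x - y)).hasFDerivAt.comp y h1
    rw [show (fun y => η (x - y)) = η ∘ (fun y => x - y) from rfl, h2.fderiv]
    ext v
    simp
  ext i
  have hgi : (gradient (η ⋆[ContinuousLinearMap.lsmul ℝ ℝ, volume] K.indicator u) x) i =
      fderiv ℝ (η ⋆[ContinuousLinearMap.lsmul ℝ ℝ, volume] K.indicator u) x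
        (EuclideanSpace.single i 1) := by
    rw [← inner_gradient_left, real_inner_comm, EuclideanSpace.inner_single_left]
    simp
  rw [hgi, hfd.fderiv, convolution_eq_swap, ContinuousLinearMap.integral_apply hex.integrable_swap,
    convolution_lsmul_swap, eval_integral_piLp fun i => ?_]
  swap
  · have := hexp.integrable_swap
    exact this.eval_piLp i
  have h1 := hw _ hφ hφc (hx.trans hKΩ) i
  have h2 : ∫ y, u y * fderiv ℝ (fun y => η (x - y)) y (EuclideanSpace.single i 1) =
      - ∫ y, (((ContinuousLinearMap.lsmul ℝ ℝ).precompL (Euc n)) (fderiv ℝ η (x - y)))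
        (K.indicator u y) (EuclideanSpace.single i 1) := by
    rw [← integral_neg]
    refine integral_congr_ae (Eventually.of_forall fun y => ?_)
    by_cases hy : y ∈ K
    · simp [hφd, hy, mul_comm]
    · have h0 : fderiv ℝ (fun y => η (x - y)) y = 0 :=
        image_eq_zero_of_notMem_tsupport fun h => hy (hx (tsupport_fderiv_subset ℝ h))
      simp [h0, hy]
  have h3 : ∫ y, p y i * η (x - y) = ∫ y, (η (x - y) • K.indicator p y) i := by
    refine integral_congr_ae (Eventually.of_forall fun y => ?_)
    by_cases hy : y ∈ K
    · simp [hy, mul_comm]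
    · have h0 : η (x - y) = 0 :=
        image_eq_zero_of_notMem_tsupport (f := fun y => η (x - y)) fun h => hy (hx h)
      simp [h0]
  rw [h2, h3, neg_inj] at h1
  exact h1

open scoped Convolution in
theorem IsYoung.convolution_le {A : ℝ → ℝ≥0∞} (hA : IsYoung A) {P : Euc n → Euc n}
    (hP : Measurable P) {lam : ℝ} (hlam : 0 < lam) (hF : ∫⁻ x, A (‖P x‖ / lam) ≠ ∞)
    (φ : ContDiffBump (0 : Euc n)) (x : Euc n) :
    A (‖(φ.normed volume ⋆[ContinuousLinearMap.lsmul ℝ ℝ, volume] P) x‖ / (2 * lam)) ≤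
      ENNReal.ofReal ((φ.normed volume ⋆[ContinuousLinearMap.lsmul ℝ ℝ, volume]
        fun y => (A (‖P y‖ / lam)).toReal) x) := by
  have hAm : Measurable fun y => A (‖P y‖ / lam) :=
    hA.measurable_comp (hP.norm.div_const lam) fun y => by positivity
  set η : Euc n → ℝ := φ.normed volume with hη
  have hηcont : Continuous η := φ.continuous_normed
  have hη0 : ∀ y, 0 ≤ η y := fun y => φ.nonneg_normed y
  have hdm : Measurable fun y => ENNReal.ofReal (η (x - y)) := by fun_prop
  set ν : Measure (Euc n) := volume.withDensity fun y => ENNReal.ofReal (η (x - y)) with hν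
  have hprob : IsProbabilityMeasure ν := by
    refine ⟨?_⟩
    rw [hν, withDensity_apply _ MeasurableSet.univ, Measure.restrict_univ,
      ← ofReal_integral_eq_lintegral_ofReal (φ.integrable_normed.comp_sub_left x)
        (Eventually.of_forall fun y => hη0 _),
      integral_sub_left_eq_self (fun y => η y) volume x, φ.integral_normed, ENNReal.ofReal_one]
  have hfi : Integrable (fun y => (A (‖P y‖ / lam)).toReal) :=
    integrable_toReal_of_lintegral_ne_top hAm.aemeasurable hF
  have hex : ConvolutionExistsAt η (fun y => (A (‖P y‖ / lam)).toReal) x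
      (ContinuousLinearMap.lsmul ℝ ℝ) volume :=
    φ.hasCompactSupport_normed.convolutionExists_left _ hηcont hfi.locallyIntegrable x
  have hint : Integrable fun y => η (x - y) • (A (‖P y‖ / lam)).toReal := hex.integrable_swap
  have hJ := hA.le_lintegral (μ := ν) (h := fun y => ‖P y‖ / lam) (fun y => by positivity)
    (s := ‖(η ⋆[ContinuousLinearMap.lsmul ℝ ℝ, volume] P) x‖ / (2 * lam)) ?_ (by positivity)
  · refine hJ.trans (le_of_eq ?_)
    rw [hν, lintegral_withDensity_eq_lintegral_mul _ hdm hAm, convolution_lsmul_swap,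
      ofReal_integral_eq_lintegral_ofReal hint
        (Eventually.of_forall fun y => smul_nonneg (hη0 _) ENNReal.toReal_nonneg)]
    refine lintegral_congr_ae ?_
    filter_upwards [ae_lt_top hAm hF] with y hy
    rw [Pi.mul_apply, smul_eq_mul, ENNReal.ofReal_mul (hη0 _), ENNReal.ofReal_toReal hy.ne]
  · have hm2 : Measurable fun y => ENNReal.ofReal (‖P y‖ / lam) := by fun_prop
    rw [hν, lintegral_withDensity_eq_lintegral_mul _ hdm hm2, convolution_lsmul_swap]
    have e : ENNReal.ofReal (2 * (‖∫ y, η (x - y) • P y‖ / (2 * lam))) =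
        ENNReal.ofReal lam⁻¹ * ‖∫ y, η (x - y) • P y‖ₑ := by
      rw [← ofReal_norm, ← ENNReal.ofReal_mul (by positivity)]
      congr 1
      field_simp
    rw [e]
    calc _ ≤ ENNReal.ofReal lam⁻¹ * ∫⁻ y, ‖η (x - y) • P y‖ₑ := by
          gcongr
          exact enorm_integral_le_lintegral_enorm _
      _ = ∫⁻ y, ENNReal.ofReal lam⁻¹ * ‖η (x - y) • P y‖ₑ :=
          (lintegral_const_mul' _ _ ENNReal.ofReal_ne_top).symm
      _ = _ := by
          refine lintegral_congr fun y => ?_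
          rw [Pi.mul_apply, ← ofReal_norm, norm_smul, Real.norm_eq_abs, abs_of_nonneg (hη0 _),
            ← ENNReal.ofReal_mul (by positivity), ← ENNReal.ofReal_mul (hη0 _)]
          congr 1
          field_simp

open scoped Convolution in
theorem exists_smooth_approx {A : ℝ → ℝ≥0∞} (hA : IsYoung A)
    (hu : LocallyIntegrableOn u Ω) (hp : Measurable p)
    (hploc : ∀ i, LocallyIntegrableOn (fun x => p x i) Ω)
    (hw : ∀ φ : Euc n → ℝ, ContDiff ℝ (⊤ : ℕ∞) φ → HasCompactSupport φ → tsupport φ ⊆ Ω →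
      ∀ i : Fin n, ∫ x, u x * fderiv ℝ φ x (EuclideanSpace.single i 1) = - ∫ x, p x i * φ x)
    {x₀ : Euc n} {R : ℝ} (hR : 0 < R) (hball : closedBall x₀ (2 * R) ⊆ Ω) {lam : ℝ}
    (hlam : 0 < lam) (hF : ∫⁻ x in closedBall x₀ (2 * R), A (‖p x‖ / lam) ≠ ∞) :
    ∃ w : ℕ → Euc n → ℝ, (∀ k, ContDiff ℝ (⊤ : ℕ∞) (w k)) ∧
      Tendsto (fun k => ∫⁻ x in ball x₀ R, ‖w k x - u x‖ₑ) atTop (𝓝 0) ∧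
      Tendsto (fun k => ∫⁻ x in ball x₀ R, ‖gradient (w k) x - p x‖ₑ) atTop (𝓝 0) ∧
      ∃ e : ℕ → Euc n → ℝ≥0∞, (∀ k, Measurable (e k)) ∧
        Tendsto (fun k => ∫⁻ x in ball x₀ R, e k x) atTop (𝓝 0) ∧
        ∀ k, ∀ x ∈ ball x₀ R,
          A (‖fderiv ℝ (w k) x‖ / (2 * lam)) ≤ A (‖p x‖ / lam) + e k x := by
  set K := closedBall x₀ (2 * R) with hK
  have hKm : MeasurableSet K := measurableSet_closedBall
  have hKc : IsCompact K := isCompact_closedBall _ _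
  have hRK : ball x₀ R ⊆ K := ball_subset_closedBall.trans (closedBall_subset_closedBall (by linarith))
  have hU : Integrable (K.indicator u) :=
    (hu.integrableOn_compact_subset hball hKc).integrable_indicator hKm
  have hP : Integrable (K.indicator p) := by
    refine IntegrableOn.integrable_indicator ?_ hKm
    exact Integrable.of_eval_piLp fun i => (hploc i).integrableOn_compact_subset hball hKc
  have hPm : Measurable (K.indicator p) := hp.indicator hKm
  have hAP : ∀ x, A (‖K.indicator p x‖ / lam) = K.indicator (fun x => A (‖p x‖ / lam)) x := by
    intro x
    by_cases hx : x ∈ K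
    · simp [hx]
    · simp [hx, hA.1]
  have hF' : ∫⁻ x, A (‖K.indicator p x‖ / lam) ≠ ∞ := by
    simp_rw [hAP]
    rwa [lintegral_indicator hKm]
  have hAm : Measurable fun y => A (‖K.indicator p y‖ / lam) :=
    hA.measurable_comp (hPm.norm.div_const lam) fun y => by positivity
  set f : Euc n → ℝ := fun x => (A (‖K.indicator p x‖ / lam)).toReal with hf
  have hfm : Measurable f := hAm.ennreal_toReal
  have hfi : Integrable f := integrable_toReal_of_lintegral_ne_top hAm.aemeasurable hF'
  let φ : ℕ → ContDiffBump (0 : Euc n) := fun k =>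
    ⟨R / (k + 2) / 2, R / (k + 2), by positivity, half_lt_self (by positivity)⟩
  have hφ : Tendsto (fun k => (φ k).rOut) atTop (𝓝 0) := by
    have := (tendsto_const_div_atTop_nhds_zero_nat R).comp (tendsto_add_atTop_nat 2)
    refine this.congr fun k => ?_
    simp [φ]
  have hφK : ∀ᶠ k in atTop, (φ k).rOut ≤ 2 * (φ k).rIn :=
    Eventually.of_forall fun k => le_of_eq (by simp only [φ]; ring)
  have hφR : ∀ k, (φ k).rOut ≤ R := fun k =>
    div_le_self hR.le (by have : (0 : ℝ) ≤ k := k.cast_nonneg; linarith)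
  have hgrad : ∀ k, ∀ x ∈ ball x₀ R, gradient ((φ k).normed volume
      ⋆[ContinuousLinearMap.lsmul ℝ ℝ, volume] K.indicator u) x = ((φ k).normed volume
        ⋆[ContinuousLinearMap.lsmul ℝ ℝ, volume] K.indicator p) x := by
    intro k x hx
    refine gradient_convolution_eq hw hball hU hP (φ k).contDiff_normed
      (φ k).hasCompactSupport_normed ?_
    have hts := tsupport_comp_eq_preimage ((φ k).normed volume) (Homeomorph.subLeft x)
    intro y hy
    have hy' : x - y ∈ tsupport ((φ k).normed volume) := by
      have : y ∈ tsupport ((φ k).normed volume ∘ (Homeomorph.subLeft x)) := hy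
      rw [hts] at this
      exact this
    rw [(φ k).tsupport_normed_eq, mem_closedBall_zero_iff] at hy'
    rw [hK, mem_closedBall]
    have h1 : dist y x ≤ R := by
      rw [dist_comm, dist_eq_norm]; exact hy'.trans (hφR k)
    have h2 : dist x x₀ < R := hx
    linarith [dist_triangle y x x₀]
  refine ⟨fun k => (φ k).normed volume ⋆[ContinuousLinearMap.lsmul ℝ ℝ, volume] K.indicator u,
    fun k => ?_, ?_, ?_, fun k x => ‖((φ k).normed volume
      ⋆[ContinuousLinearMap.lsmul ℝ ℝ, volume] f) x - f x‖ₑ, fun k => ?_, ?_, fun k x hx => ?_⟩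
  · exact (φ k).hasCompactSupport_normed.contDiff_convolution_left _ (φ k).contDiff_normed
      hU.locallyIntegrable
  · refine tendsto_of_tendsto_of_tendsto_of_le_of_le tendsto_const_nhds
      (tendsto_lintegral_convolution_sub hU hφ hφK) (fun k => zero_le) fun k => ?_
    refine le_trans (le_of_eq ?_) (setLIntegral_le_lintegral (ball x₀ R) _)
    refine setLIntegral_congr_fun measurableSet_ball fun x hx => ?_
    simp only [indicator_of_mem (hRK hx)]
  · refine tendsto_of_tendsto_of_tendsto_of_le_of_le tendsto_const_nhds
      (tendsto_lintegral_convolution_sub hP hφ hφK) (fun k => zero_le) fun k => ?_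
    refine le_trans (le_of_eq ?_) (setLIntegral_le_lintegral (ball x₀ R) _)
    refine setLIntegral_congr_fun measurableSet_ball fun x hx => ?_
    simp only [hgrad k x hx, indicator_of_mem (hRK hx)]
  · have : Continuous ((φ k).normed volume ⋆[ContinuousLinearMap.lsmul ℝ ℝ, volume] f) :=
      (φ k).hasCompactSupport_normed.continuous_convolution_left _ (φ k).continuous_normed
        hfi.locallyIntegrable
    exact (this.measurable.sub hfm).enorm
  · refine tendsto_of_tendsto_of_tendsto_of_le_of_le tendsto_const_nhds
      (tendsto_lintegral_convolution_sub hfi hφ hφK) (fun k => zero_le) fun k => ?_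
    exact setLIntegral_le_lintegral (ball x₀ R) _
  · rw [← norm_gradient_eq_norm_fderiv, hgrad k x hx]
    refine (hA.convolution_le hPm hlam hF' (φ k) x).trans ?_
    have h1 : A (‖p x‖ / lam) = A (‖K.indicator p x‖ / lam) := by
      rw [indicator_of_mem (hRK hx)]
    rw [h1]
    calc _ ≤ ENNReal.ofReal (f x + ‖((φ k).normed volume
          ⋆[ContinuousLinearMap.lsmul ℝ ℝ, volume] f) x - f x‖) := by
          refine ENNReal.ofReal_le_ofReal ?_
          have := le_abs_self (((φ k).normed volume
            ⋆[ContinuousLinearMap.lsmul ℝ ℝ, volume] f) x - f x)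
          rw [Real.norm_eq_abs]
          linarith
      _ ≤ _ := by
          rw [ENNReal.ofReal_add ENNReal.toReal_nonneg (norm_nonneg _), ofReal_norm]
          gcongr
          exact ENNReal.ofReal_toReal_le

end SmoothApproximation

section Truncation

theorem exists_smooth_posPart : ∃ (q : ℝ → ℝ) (C : ℝ), ContDiff ℝ (⊤ : ℕ∞) q ∧
    (∀ t ≤ 0, q t = 0) ∧ (∀ t, |q t - max t 0| ≤ 1) ∧ (∀ t, |deriv q t| ≤ C) ∧
    (∀ t ≤ 0, deriv q t = 0) ∧ ∀ t, 1 < t → deriv q t = 1 := by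
  have hq : ContDiff ℝ (⊤ : ℕ∞) fun t : ℝ => t * Real.smoothTransition t :=
    contDiff_id.mul Real.smoothTransition.contDiff
  set q : ℝ → ℝ := fun t => t * Real.smoothTransition t with hqd
  have hq0 : ∀ t ≤ 0, q t = 0 := fun t ht => by
    simp [hqd, Real.smoothTransition.zero_of_nonpos ht]
  have hq1 : ∀ t, 1 ≤ t → q t = t := fun t ht => by
    simp [hqd, Real.smoothTransition.one_of_one_le ht]
  have hdc : Continuous (deriv q) := hq.continuous_deriv (by simp)
  have hd0 : ∀ t < 0, deriv q t = 0 := fun t ht => by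
    have : q =ᶠ[𝓝 t] fun _ => 0 := by
      filter_upwards [Iio_mem_nhds ht] with s hs using hq0 s (le_of_lt hs)
    rw [this.deriv_eq, deriv_const]
  have hd0' : ∀ t ≤ 0, deriv q t = 0 := by
    intro t ht
    have hcl : IsClosed {t : ℝ | deriv q t = 0} := isClosed_eq hdc continuous_const
    have : closure (Iio (0 : ℝ)) ⊆ {t : ℝ | deriv q t = 0} :=
      closure_minimal (fun t ht => hd0 t ht) hcl
    rw [closure_Iio] at this
    exact this ht
  have hd1 : ∀ t, 1 < t → deriv q t = 1 := fun t ht => by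
    have : q =ᶠ[𝓝 t] fun s => s := by
      filter_upwards [Ioi_mem_nhds ht] with s hs using hq1 s (le_of_lt hs)
    rw [this.deriv_eq, deriv_id'']
  obtain ⟨C, hC⟩ := (isCompact_Icc (a := (0 : ℝ)) (b := 1)).exists_bound_of_continuousOn
    hdc.continuousOn
  refine ⟨q, max C 1, hq, hq0, fun t => ?_, fun t => ?_, hd0', hd1⟩
  · rcases le_total t 0 with h | h
    · simp [hq0 t h, h]
    rcases le_total 1 t with h' | h'
    · simp [hq1 t h', h]
    · have h1 := Real.smoothTransition.nonneg t
      have h2 := Real.smoothTransition.le_one t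
      rw [max_eq_left h, abs_le]
      constructor <;> simp only [hqd] <;> nlinarith
  · rcases le_total t 0 with h | h
    · simp [hd0' t h]
    rcases le_or_gt t 1 with h' | h'
    · exact (hC t ⟨h, h'⟩).trans (le_max_left _ _)
    · simp [hd1 t h']

theorem exists_smooth_truncation (m M : ℝ) : ∃ (T : ℕ → ℝ → ℝ) (C : ℝ),
    (∀ j, ContDiff ℝ (⊤ : ℕ∞) (T j)) ∧ (∀ j s, m ≤ s → s ≤ M → T j s = 0) ∧
    (∀ j s, |T j s - (max (s - M) 0 - max (m - s) 0)| ≤ 2 / ((j : ℝ) + 1)) ∧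
    (∀ j s, |deriv (T j) s| ≤ C) ∧
    ∀ s, Tendsto (fun j => deriv (T j) s) atTop
      (𝓝 ((if M < s then 1 else 0) + (if s < m then 1 else 0))) := by
  obtain ⟨q, C, hq, hq0, hqb, hqC, hd0, hd1⟩ := exists_smooth_posPart
  have hder : ∀ (j : ℕ) (s : ℝ), HasDerivAt (fun s : ℝ => (q (((j : ℝ) + 1) * (s - M)) -
      q (((j : ℝ) + 1) * (m - s))) / ((j : ℝ) + 1))
      (deriv q (((j : ℝ) + 1) * (s - M)) + deriv q (((j : ℝ) + 1) * (m - s))) s := by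
    intro j s
    have hqd : ∀ t, HasDerivAt q (deriv q t) t := fun t =>
      (hq.differentiable (by simp) t).hasDerivAt
    have h1 : HasDerivAt (fun s : ℝ => ((j : ℝ) + 1) * (s - M)) (((j : ℝ) + 1) * 1) s :=
      ((hasDerivAt_id s).sub_const M).const_mul _
    have h2 : HasDerivAt (fun s : ℝ => ((j : ℝ) + 1) * (m - s)) (((j : ℝ) + 1) * -1) s :=
      ((hasDerivAt_id s).const_sub m).const_mul _
    have h3 := (((hqd _).comp s h1).sub ((hqd _).comp s h2)).div_const ((j : ℝ) + 1)
    refine h3.congr_deriv ?_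
    field_simp
    ring
  have htend : ∀ x : ℝ, Tendsto (fun j : ℕ => deriv q (((j : ℝ) + 1) * x)) atTop
      (𝓝 (if 0 < x then 1 else 0)) := by
    intro x
    split_ifs with hx
    · refine tendsto_const_nhds.congr' ?_
      have : Tendsto (fun j : ℕ => ((j : ℝ) + 1) * x) atTop atTop :=
        (tendsto_atTop_add_const_right _ _ tendsto_natCast_atTop_atTop).atTop_mul_const hx
      filter_upwards [this.eventually_gt_atTop 1] with j hj using (hd1 _ hj).symm
    · refine tendsto_const_nhds.congr fun j => (hd0 _ ?_).symm
      exact mul_nonpos_of_nonneg_of_nonpos (by positivity) (not_lt.1 hx)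
  refine ⟨fun j s => (q (((j : ℝ) + 1) * (s - M)) - q (((j : ℝ) + 1) * (m - s))) / ((j : ℝ) + 1),
    C + C, fun j => ?_, fun j s h1 h2 => ?_, fun j s => ?_, fun j s => ?_, fun s => ?_⟩
  · refine ContDiff.div_const (ContDiff.sub (hq.comp ?_) (hq.comp ?_)) _
    · exact contDiff_const.mul (contDiff_id.sub contDiff_const)
    · exact contDiff_const.mul (contDiff_const.sub contDiff_id)
  · have hj : (0 : ℝ) ≤ (j : ℝ) + 1 := by positivity
    simp [hq0 _ (mul_nonpos_of_nonneg_of_nonpos hj (sub_nonpos.2 h2)),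
      hq0 _ (mul_nonpos_of_nonneg_of_nonpos hj (sub_nonpos.2 h1))]
  · have hj : (0 : ℝ) < (j : ℝ) + 1 := by positivity
    have key : ∀ x : ℝ, max (((j : ℝ) + 1) * x) 0 = ((j : ℝ) + 1) * max x 0 := fun x => by
      rw [mul_max_of_nonneg _ _ hj.le, mul_zero]
    have h1 := hqb (((j : ℝ) + 1) * (s - M))
    have h2 := hqb (((j : ℝ) + 1) * (m - s))
    rw [key] at h1 h2
    have e : (q (((j : ℝ) + 1) * (s - M)) - q (((j : ℝ) + 1) * (m - s))) / ((j : ℝ) + 1) -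
        (max (s - M) 0 - max (m - s) 0) =
        ((q (((j : ℝ) + 1) * (s - M)) - ((j : ℝ) + 1) * max (s - M) 0) -
          (q (((j : ℝ) + 1) * (m - s)) - ((j : ℝ) + 1) * max (m - s) 0)) / ((j : ℝ) + 1) := by
      field_simp
      ring
    rw [e, abs_div, abs_of_pos hj]
    gcongr
    exact (abs_sub _ _).trans (by linarith)
  · rw [(hder j s).deriv]
    exact (abs_add_le _ _).trans (add_le_add (hqC _) (hqC _))
  · simp_rw [(hder _ s).deriv]
    refine Tendsto.add ?_ ?_
    · simpa only [sub_pos] using htend (s - M)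
    · simpa only [sub_pos] using htend (m - s)

end Truncation

section WeakLimits

variable {n : ℕ} {B : Set (Euc n)} {v : Euc n → ℝ} {h : Euc n → Euc n}

theorem isWeakGradOn_of_tendsto (hv : IntegrableOn v B) (hh : IntegrableOn h B)
    {φ : ℕ → Euc n → ℝ}
    (hφ : ∀ k, ContDiff ℝ (⊤ : ℕ∞) (φ k) ∧ HasCompactSupport (φ k) ∧ tsupport (φ k) ⊆ B)
    (hφv : Tendsto (fun k => ∫⁻ x in B, ‖φ k x - v x‖ₑ) atTop (𝓝 0))
    (hφh : Tendsto (fun k => ∫⁻ x in B, ‖gradient (φ k) x - h x‖ₑ) atTop (𝓝 0)) :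
    IsWeakGradOn B v h := by
  refine ⟨hv.locallyIntegrableOn, IntegrableOn.locallyIntegrableOn (Integrable.norm hh),
    fun ψ hψ hψc hψB i => ?_⟩
  have hψ1 : ContDiff ℝ 1 ψ := hψ.of_le (by exact_mod_cast le_top)
  have hdc : Continuous fun x => fderiv ℝ ψ x (EuclideanSpace.single i 1) :=
    (hψ1.continuous_fderiv one_ne_zero).clm_apply continuous_const
  have hdcs : HasCompactSupport fun x => fderiv ℝ ψ x (EuclideanSpace.single i 1) :=
    (hψc.fderiv_apply ℝ (EuclideanSpace.single i 1))
  obtain ⟨C₁, hC₁⟩ := hdc.bounded_above_of_compact_support hdcs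
  obtain ⟨C₂, hC₂⟩ := hψ.continuous.bounded_above_of_compact_support hψc
  have hout : ∀ x ∉ B, ψ x = 0 ∧ fderiv ℝ ψ x (EuclideanSpace.single i 1) = 0 := by
    intro x hx
    refine ⟨image_eq_zero_of_notMem_tsupport fun h => hx (hψB h), ?_⟩
    rw [image_eq_zero_of_notMem_tsupport (f := fderiv ℝ ψ)
      fun h => hx (hψB (tsupport_fderiv_subset ℝ h)), zero_apply]
  have hcoord : ∀ k x, gradient (φ k) x i = fderiv ℝ (φ k) x (EuclideanSpace.single i 1) := by
    intro k x
    rw [← inner_gradient_left, real_inner_comm, EuclideanSpace.inner_single_left]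
    simp
  have hφ1 : ∀ k, ContDiff ℝ 1 (φ k) := fun k => (hφ k).1.of_le (by exact_mod_cast le_top)
  have hφg : ∀ k, Continuous fun x => gradient (φ k) x i := by
    intro k
    simp_rw [hcoord]
    exact ((hφ1 k).continuous_fderiv one_ne_zero).clm_apply continuous_const
  have hparts : ∀ k, ∫ x in B, φ k x * fderiv ℝ ψ x (EuclideanSpace.single i 1) =
      - ∫ x in B, gradient (φ k) x i * ψ x := by
    intro k
    rw [setIntegral_eq_integral_of_forall_compl_eq_zero fun x hx => by simp [(hout x hx).2],
      setIntegral_eq_integral_of_forall_compl_eq_zero fun x hx => by simp [(hout x hx).1],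
      integral_mul_fderiv_eq_neg_fderiv_mul_of_integrable]
    · simp_rw [hcoord]
    · refine Continuous.integrable_of_hasCompactSupport ?_ hψc.mul_left
      exact (((hφ1 k).continuous_fderiv one_ne_zero).clm_apply continuous_const).mul hψ.continuous
    · exact ((hφ k).1.continuous.mul hdc).integrable_of_hasCompactSupport hdcs.mul_left
    · exact ((hφ k).1.continuous.mul hψ.continuous).integrable_of_hasCompactSupport hψc.mul_left
    · exact fun x _ => (hφ1 k).differentiable one_ne_zero x
    · exact fun x _ => hψ1.differentiable one_ne_zero x
  have key : ∀ (F : ℕ → Euc n → ℝ) (f : Euc n → ℝ) (b : Euc n → ℝ) (C : ℝ), Continuous b →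
      (∀ x, ‖b x‖ ≤ C) → IntegrableOn f B → (∀ k, Continuous (F k)) → HasCompactSupport b →
      Tendsto (fun k => ∫⁻ x in B, ‖F k x - f x‖ₑ) atTop (𝓝 0) →
      Tendsto (fun k => ∫ x in B, F k x * b x) atTop (𝓝 (∫ x in B, f x * b x)) := by
    intro F f b C hb hbC hf hF hbc hFf
    refine tendsto_integral_of_L1 _ (hf.mul_bdd (c := C) hb.aestronglyMeasurable
      (Eventually.of_forall hbC)).aestronglyMeasurable (Eventually.of_forall fun k =>
        (((hF k).mul hb).integrable_of_hasCompactSupport hbc.mul_left).integrableOn) ?_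
    have h0 := ENNReal.Tendsto.mul_const hFf (b := ENNReal.ofReal C)
      (Or.inr ENNReal.ofReal_ne_top)
    rw [zero_mul] at h0
    refine tendsto_of_tendsto_of_tendsto_of_le_of_le tendsto_const_nhds h0 (fun k => zero_le) ?_
    intro k
    dsimp only
    rw [← lintegral_mul_const' _ _ ENNReal.ofReal_ne_top]
    refine lintegral_mono fun x => ?_
    rw [← sub_mul, enorm_mul, ← ofReal_norm (b x)]
    gcongr
    exact hbC x
  have hhi : IntegrableOn (fun x => h x i) B := hh.eval_piLp i
  have hL := key φ v _ C₁ hdc hC₁ hv (fun k => (hφ k).1.continuous) hdcs hφv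
  have hR := key (fun k x => gradient (φ k) x i) (fun x => h x i) ψ C₂ hψ.continuous hC₂ hhi hφg
    hψc (by
      refine tendsto_of_tendsto_of_tendsto_of_le_of_le tendsto_const_nhds hφh
        (fun k => zero_le) fun k => lintegral_mono fun x => ?_
      rw [← PiLp.sub_apply, enorm_le_iff_norm_le]
      exact PiLp.norm_apply_le _ _)
  have hfin := tendsto_nhds_unique (hL.congr hparts) hR.neg
  rw [setIntegral_eq_integral_of_forall_compl_eq_zero fun x hx => by simp [(hout x hx).2],
    setIntegral_eq_integral_of_forall_compl_eq_zero fun x hx => by simp [(hout x hx).1]] at hfin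
  exact hfin

theorem memW110_of_tendsto (hv : IntegrableOn v B) (hh : IntegrableOn h B)
    {φ : ℕ → Euc n → ℝ}
    (hφ : ∀ k, ContDiff ℝ (⊤ : ℕ∞) (φ k) ∧ HasCompactSupport (φ k) ∧ tsupport (φ k) ⊆ B)
    (hφv : Tendsto (fun k => ∫⁻ x in B, ‖φ k x - v x‖ₑ) atTop (𝓝 0))
    (hφh : Tendsto (fun k => ∫⁻ x in B, ‖gradient (φ k) x - h x‖ₑ) atTop (𝓝 0)) :
    MemW110 B v := by
  refine ⟨h, isWeakGradOn_of_tendsto hv hh hφ hφv hφh, φ, hφ, ?_⟩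
  have h1 := hφv.add hφh
  rw [add_zero] at h1
  rw [tendsto_zero_iff_enorm_tendsto_zero]
  refine tendsto_of_tendsto_of_tendsto_of_le_of_le tendsto_const_nhds h1 (fun k => zero_le) ?_
  intro k
  refine (enorm_integral_le_lintegral_enorm _).trans ?_
  dsimp only
  rw [← lintegral_add_left']
  · refine lintegral_mono fun x => ?_
    refine (enorm_add_le _ _).trans (le_of_eq ?_)
    rw [enorm_norm, ← Real.norm_eq_abs, enorm_norm]
  · exact ((hφ k).1.continuous.aestronglyMeasurable.sub hv.aestronglyMeasurable).enorm

end WeakLimits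

section TruncationTrace

variable {n : ℕ} {u : Euc n → ℝ} {p : Euc n → Euc n}

theorem contDiff_indicator_of_eventuallyEq_zero {B : Set (Euc n)} (hB : IsOpen B)
    (hBb : IsCompact (closure B)) {f : Euc n → ℝ} (hf : ContDiff ℝ (⊤ : ℕ∞) f)
    (h0 : ∀ x ∈ frontier B, f =ᶠ[𝓝 x] 0) :
    ContDiff ℝ (⊤ : ℕ∞) (B.indicator f) ∧ HasCompactSupport (B.indicator f) ∧
      tsupport (B.indicator f) ⊆ B := by
  have hfr : ∀ x ∉ B, B.indicator f =ᶠ[𝓝 x] 0 := by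
    intro x hx
    by_cases hxc : x ∈ closure B
    · have : x ∈ frontier B := by rw [hB.frontier_eq]; exact ⟨hxc, hx⟩
      filter_upwards [h0 x this] with y hy
      by_cases hyB : y ∈ B
      · rw [indicator_of_mem hyB, hy]
      · rw [indicator_of_notMem hyB]; rfl
    · filter_upwards [isClosed_closure.isOpen_compl.mem_nhds hxc] with y hy
      rw [indicator_of_notMem fun h => hy (subset_closure h)]; rfl
  have hts : tsupport (B.indicator f) ⊆ B := by
    intro x hx
    by_contra hxB
    exact (notMem_tsupport_iff_eventuallyEq.2 (hfr x hxB)) hx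
  refine ⟨contDiff_iff_contDiffAt.2 fun x => ?_, ?_, hts⟩
  · by_cases hx : x ∈ B
    · refine hf.contDiffAt.congr_of_eventuallyEq ?_
      filter_upwards [hB.mem_nhds hx] with y hy using indicator_of_mem hy _
    · exact contDiffAt_const.congr_of_eventuallyEq (hfr x hx)
  · exact hBb.of_isClosed_subset (isClosed_tsupport _) (hts.trans subset_closure)

theorem gradient_indicator_comp {B : Set (Euc n)} (hB : IsOpen B) {T : ℝ → ℝ}
    (hT : Differentiable ℝ T) {w : Euc n → ℝ} (hw : Differentiable ℝ w) {x : Euc n}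
    (hx : x ∈ B) :
    gradient (B.indicator (T ∘ w)) x = deriv T (w x) • gradient w x := by
  have h1 : B.indicator (T ∘ w) =ᶠ[𝓝 x] T ∘ w := by
    filter_upwards [hB.mem_nhds hx] with y hy using indicator_of_mem hy _
  have h2 : fderiv ℝ (T ∘ w) x = deriv T (w x) • fderiv ℝ w x :=
    ((hT (w x)).hasDerivAt.comp_hasFDerivAt x (hw x).hasFDerivAt).fderiv
  rw [gradient, gradient, h1.fderiv_eq, h2, map_smul]

theorem memW110_truncation {x₀ : Euc n} {r : ℝ}
    (hu : IntegrableOn u (ball x₀ r)) (hp : IntegrableOn p (ball x₀ r)) {w : ℕ → Euc n → ℝ}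
    (hw : ∀ k, ContDiff ℝ (⊤ : ℕ∞) (w k))
    (hwu : Tendsto (fun k => ∫⁻ x in ball x₀ r, ‖w k x - u x‖ₑ) atTop (𝓝 0))
    (hwp : Tendsto (fun k => ∫⁻ x in ball x₀ r, ‖gradient (w k) x - p x‖ₑ) atTop (𝓝 0))
    (hae : ∀ᵐ x ∂volume.restrict (ball x₀ r), Tendsto (fun k => w k x) atTop (𝓝 (u x)))
    {m M : ℝ}
    (hfr : ∀ᶠ k in atTop, ∀ x ∈ sphere x₀ r, m < w k x ∧ w k x < M) :
    MemW110 (ball x₀ r) fun x => max (u x - M) 0 - max (m - u x) 0 := by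
  set B := ball x₀ r with hB
  obtain ⟨T, C, hTs, hT0, hTb, hTC, hTl⟩ := exists_smooth_truncation m M
  have hC : 0 ≤ C := (abs_nonneg _).trans (hTC 0 0)
  have hTd : ∀ j, Continuous (deriv (T j)) := fun j => (hTs j).continuous_deriv (by simp)
  set D : ℝ → ℝ := fun s => (if M < s then 1 else 0) + (if s < m then 1 else 0) with hD
  have hDm : Measurable D :=
    (Measurable.ite measurableSet_Ioi measurable_const measurable_const).add
      (Measurable.ite measurableSet_Iio measurable_const measurable_const)
  have hDC : ∀ s, |D s| ≤ C := fun s =>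
    le_of_tendsto (hTl s).abs (Eventually.of_forall fun j => hTC j s)
  set P : ℝ → ℝ := fun s => max (s - M) 0 - max (m - s) 0 with hP
  have hPl : ∀ s t, |P s - P t| ≤ 2 * |s - t| := by
    intro s t
    have h1 := abs_max_sub_max_le_abs (s - M) (t - M) 0
    have h2 := abs_max_sub_max_le_abs (m - s) (m - t) 0
    rw [sub_sub_sub_cancel_right] at h1
    rw [show m - s - (m - t) = t - s by ring, abs_sub_comm t s] at h2
    have e : P s - P t = (max (s - M) 0 - max (t - M) 0) - (max (m - s) 0 - max (m - t) 0) := by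
      simp only [hP]; ring
    rw [e]
    exact (abs_sub _ _).trans (by linarith)
  have hPc : Continuous P := by fun_prop
  have hvol : volume B ≠ ∞ := measure_ball_lt_top.ne
  have hum : AEStronglyMeasurable u (volume.restrict B) := hu.aestronglyMeasurable
  have hpm : AEStronglyMeasurable p (volume.restrict B) := hp.aestronglyMeasurable
  have hpf : ∫⁻ x in B, ‖p x‖ₑ ≠ ∞ := hp.2.ne
  have hDu : AEStronglyMeasurable (fun x => D (u x)) (volume.restrict B) :=
    (hDm.comp_aemeasurable hum.aemeasurable).aestronglyMeasurable
  -- the truncation of `u` is integrable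
  have hv : IntegrableOn (fun x => P (u x)) B := by
    have : IntegrableOn (fun x => 2 * ‖u x‖ + |P 0|) B :=
      (hu.norm.const_mul 2).add (integrableOn_const hvol)
    refine this.mono' (hPc.comp_aestronglyMeasurable hum) (Eventually.of_forall fun x => ?_)
    have := hPl (u x) 0
    rw [sub_zero] at this
    rw [Real.norm_eq_abs, Real.norm_eq_abs]
    linarith [abs_sub_abs_le_abs_sub (P (u x)) (P 0)]
  have hh : IntegrableOn (fun x => D (u x) • p x) B :=
    hp.bdd_smul C hDu (Eventually.of_forall fun x => hDC _)
  -- convergence for a fixed truncation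
  have hk : ∀ j, Tendsto (fun k => ∫⁻ x in B,
      ‖deriv (T j) (w k x) • gradient (w k) x - deriv (T j) (u x) • p x‖ₑ) atTop (𝓝 0) := by
    intro j
    have hl : Tendsto (fun k => ∫⁻ x in B, ‖deriv (T j) (w k x) - deriv (T j) (u x)‖ₑ * ‖p x‖ₑ)
        atTop (𝓝 (∫⁻ x in B, 0)) := by
      refine tendsto_lintegral_of_dominated_convergence' (fun x => ENNReal.ofReal (C + C) * ‖p x‖ₑ)
        (fun k => ?_) (fun k => Eventually.of_forall fun x => ?_) ?_ ?_
      · exact ((((hTd j).comp (hw k).continuous).aestronglyMeasurable.sub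
          ((hTd j).comp_aestronglyMeasurable hum)).enorm).mul hpm.enorm
      · dsimp only
        rw [← ofReal_norm (deriv (T j) (w k x) - deriv (T j) (u x))]
        gcongr
        exact (norm_sub_le _ _).trans (add_le_add (hTC _ _) (hTC _ _))
      · rw [lintegral_const_mul' _ _ ENNReal.ofReal_ne_top]
        exact ENNReal.mul_ne_top ENNReal.ofReal_ne_top hpf
      · filter_upwards [hae] with x hx
        have h1 : Tendsto (fun k => deriv (T j) (w k x) - deriv (T j) (u x)) atTop (𝓝 0) := by
          rw [← sub_self (deriv (T j) (u x))]
          exact (((hTd j).tendsto _).comp hx).sub tendsto_const_nhds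
        have h2 := ENNReal.Tendsto.mul_const h1.enorm (b := ‖p x‖ₑ) (Or.inr enorm_ne_top)
        simpa using h2
    have h2 := (ENNReal.Tendsto.const_mul hwp (a := ENNReal.ofReal C)
      (Or.inr ENNReal.ofReal_ne_top)).add hl
    simp only [mul_zero, lintegral_zero, add_zero] at h2
    refine tendsto_of_tendsto_of_tendsto_of_le_of_le tendsto_const_nhds h2 (fun k => zero_le) ?_
    intro k
    dsimp only
    have hgm : Continuous fun x => gradient (w k) x :=
      (InnerProductSpace.toDual ℝ (Euc n)).symm.continuous.comp
        ((hw k).continuous_fderiv (by simp))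
    rw [← lintegral_const_mul' _ _ ENNReal.ofReal_ne_top, ← lintegral_add_left']
    · refine lintegral_mono fun x => ?_
      have e : deriv (T j) (w k x) • gradient (w k) x - deriv (T j) (u x) • p x =
          deriv (T j) (w k x) • (gradient (w k) x - p x) +
            (deriv (T j) (w k x) - deriv (T j) (u x)) • p x := by
        rw [smul_sub, sub_smul]; abel
      rw [e]
      refine (enorm_add_le _ _).trans ?_
      rw [enorm_smul, enorm_smul, ← ofReal_norm (deriv (T j) (w k x))]
      gcongr
      exact hTC _ _
    · exact ((hgm.aestronglyMeasurable.sub hpm).enorm).const_mul _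
  -- convergence of the truncations
  have hj : Tendsto (fun j => ∫⁻ x in B, ‖deriv (T j) (u x) • p x - D (u x) • p x‖ₑ)
      atTop (𝓝 0) := by
    have hl : Tendsto (fun j => ∫⁻ x in B, ‖deriv (T j) (u x) • p x - D (u x) • p x‖ₑ)
        atTop (𝓝 (∫⁻ x in B, 0)) := by
      refine tendsto_lintegral_of_dominated_convergence' (fun x => ENNReal.ofReal (C + C) * ‖p x‖ₑ)
        (fun k => ?_) (fun k => Eventually.of_forall fun x => ?_) ?_ ?_
      · exact ((((hTd k).comp_aestronglyMeasurable hum).smul hpm).sub (hDu.smul hpm)).enorm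
      · dsimp only
        rw [← sub_smul, enorm_smul, ← ofReal_norm (deriv (T k) (u x) - D (u x))]
        gcongr
        exact (norm_sub_le _ _).trans (add_le_add (hTC _ _) (hDC _))
      · rw [lintegral_const_mul' _ _ ENNReal.ofReal_ne_top]
        exact ENNReal.mul_ne_top ENNReal.ofReal_ne_top hpf
      · filter_upwards with x
        have h1 := ((hTl (u x)).smul_const (p x)).sub_const (D (u x) • p x)
        rw [sub_self] at h1
        simpa using h1.enorm
    simpa using hl
  have hdiag : ∀ j : ℕ, ∃ k, (∀ x ∈ sphere x₀ r, m < w k x ∧ w k x < M) ∧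
      ∫⁻ x in B, ‖w k x - u x‖ₑ ≤ ENNReal.ofReal (1 / ((j : ℝ) + 1)) ∧
      ∫⁻ x in B, ‖deriv (T j) (w k x) • gradient (w k) x - deriv (T j) (u x) • p x‖ₑ ≤
        ENNReal.ofReal (1 / ((j : ℝ) + 1)) := by
    intro j
    have hpos : 0 < ENNReal.ofReal (1 / ((j : ℝ) + 1)) := ENNReal.ofReal_pos.2 (by positivity)
    obtain ⟨k, h1, h2, h3⟩ := (hfr.and ((hwu.eventually_lt_const hpos).and
      ((hk j).eventually_lt_const hpos))).exists
    exact ⟨k, h1, h2.le, h3.le⟩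
  choose κ hκ1 hκ2 hκ3 using hdiag
  have hone : Tendsto (fun j : ℕ => ENNReal.ofReal (1 / ((j : ℝ) + 1))) atTop (𝓝 0) := by
    simpa using ENNReal.tendsto_ofReal tendsto_one_div_add_atTop_nhds_zero_nat
  refine memW110_of_tendsto (h := fun x => D (u x) • p x) hv hh
    (φ := fun j => B.indicator (T j ∘ w (κ j))) (fun j => ?_) ?_ ?_
  · refine contDiff_indicator_of_eventuallyEq_zero isOpen_ball
      ((isCompact_closedBall x₀ r).of_isClosed_subset isClosed_closure closure_ball_subset_closedBall)
      ((hTs j).comp (hw _)) fun x hx => ?_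
    have h1 := hκ1 j x (frontier_ball_subset_sphere hx)
    have hc := (hw (κ j)).continuous.tendsto x
    filter_upwards [hc.eventually_const_lt h1.1, hc.eventually_lt_const h1.2] with y h2 h3
      using hT0 j _ h2.le h3.le
  · have h1 : Tendsto (fun j : ℕ => ENNReal.ofReal 2 * ENNReal.ofReal (1 / ((j : ℝ) + 1)) * volume B
        + ENNReal.ofReal 2 * ENNReal.ofReal (1 / ((j : ℝ) + 1))) atTop (𝓝 0) := by
      have h2 := ENNReal.Tendsto.const_mul hone (a := ENNReal.ofReal 2)
        (Or.inr ENNReal.ofReal_ne_top)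
      have h3 := (ENNReal.Tendsto.mul_const h2 (b := volume B) (Or.inr hvol)).add h2
      simpa using h3
    refine tendsto_of_tendsto_of_tendsto_of_le_of_le tendsto_const_nhds h1 (fun k => zero_le) ?_
    intro j
    dsimp only
    calc ∫⁻ x in B, ‖B.indicator (T j ∘ w (κ j)) x - P (u x)‖ₑ
        ≤ ∫⁻ x in B, (ENNReal.ofReal 2 * ENNReal.ofReal (1 / ((j : ℝ) + 1)) +
            ENNReal.ofReal 2 * ‖w (κ j) x - u x‖ₑ) := by
          refine setLIntegral_mono_ae' measurableSet_ball (Eventually.of_forall fun x hx => ?_)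
          rw [indicator_of_mem hx, ← ofReal_norm, ← ofReal_norm, ← ENNReal.ofReal_mul zero_le_two,
            ← ENNReal.ofReal_mul zero_le_two, ← ENNReal.ofReal_add (by positivity) (by positivity)]
          refine ENNReal.ofReal_le_ofReal ?_
          rw [Real.norm_eq_abs, Real.norm_eq_abs, Function.comp_apply]
          have h1 := hTb j (w (κ j) x)
          have h2 := hPl (w (κ j) x) (u x)
          rw [mul_one_div]
          exact (abs_sub_le _ (P (w (κ j) x)) _).trans (add_le_add h1 h2)
      _ = ENNReal.ofReal 2 * ENNReal.ofReal (1 / ((j : ℝ) + 1)) * volume B +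
            ENNReal.ofReal 2 * ∫⁻ x in B, ‖w (κ j) x - u x‖ₑ := by
          rw [lintegral_add_left measurable_const, setLIntegral_const,
            lintegral_const_mul' _ _ ENNReal.ofReal_ne_top]
      _ ≤ _ := by
          gcongr
          exact hκ2 j
  · have h1 := hone.add hj
    rw [add_zero] at h1
    refine tendsto_of_tendsto_of_tendsto_of_le_of_le tendsto_const_nhds h1 (fun k => zero_le) ?_
    intro j
    dsimp only
    refine le_trans ?_ (add_le_add_left (hκ3 j) _)
    rw [← lintegral_add_right']
    · refine setLIntegral_mono_ae' measurableSet_ball (Eventually.of_forall fun x hx => ?_)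
      rw [gradient_indicator_comp isOpen_ball ((hTs j).differentiable (by simp))
        ((hw _).differentiable (by simp)) hx]
      refine le_trans (le_of_eq ?_) (enorm_add_le _ _)
      rw [sub_add_sub_cancel]
    · exact ((((hTd j).comp_aestronglyMeasurable hum).smul hpm).sub (hDu.smul hpm)).enorm

end TruncationTrace

section OscillationOnSpheres

variable {n : ℕ} {Ω : Set (Euc n)} {u : Euc n → ℝ} {p : Euc n → Euc n}

theorem youngShifted_mono {A : ℝ → ℝ≥0∞} (hA : IsYoung A) : MonotoneOn (youngShifted n A) (Ici 0) := by
  unfold youngShifted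
  split_ifs
  · exact fun x hx y _ hxy => hA.mono hx hxy
  · exact (youngConj_mono _).monotoneOn _

/-- From an `L¹`-null sequence one can extract a subsequence with summable integrals. -/
theorem exists_subseq_tsum_ne_top {a : ℕ → ℝ≥0∞} (ha : Tendsto a atTop (𝓝 0)) :
    ∃ ns : ℕ → ℕ, StrictMono ns ∧ ∑' k, a (ns k) ≠ ∞ := by
  have h : ∀ k : ℕ, ∀ᶠ j in atTop, a j ≤ (2 : ℝ≥0∞)⁻¹ ^ k := fun k =>
    (ha.eventually_lt_const (ENNReal.pow_pos (by simp) k)).mono fun j hj => hj.le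
  obtain ⟨ns, hns, hle⟩ := extraction_forall_of_eventually h
  refine ⟨ns, hns, ne_top_of_le_ne_top ?_ (ENNReal.tsum_le_tsum hle)⟩
  rw [ENNReal.tsum_geometric]
  simp [ENNReal.one_sub_inv_two]

theorem youngShifted_le_of_sphere {A : ℝ → ℝ≥0∞} (hA : IsYoung A) {C : ℝ} (hC : 0 < C)
    (hsph : ∀ w : Euc n → ℝ, ContDiff ℝ 1 w → ∀ a b : Euc n, ‖a‖ = 1 → ‖b‖ = 1 →
      youngShifted n A (|w a - w b| / C) ≤
        ENNReal.ofReal C * ∫⁻ θ : sphere (0 : Euc n) 1, A ‖fderiv ℝ w θ‖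
          ∂(volume : Measure (Euc n)).toSphere)
    {w : Euc n → ℝ} (hw : ContDiff ℝ 1 w) {x₀ : Euc n} {r lam : ℝ} (hr : 0 < r) (hlam : 0 < lam)
    {x y : Euc n} (hx : x ∈ sphere x₀ r) (hy : y ∈ sphere x₀ r) {d : ℝ} (hd0 : 0 ≤ d)
    (hd : d ≤ |w x - w y|) :
    youngShifted n A (d / (lam * C) * (1 / r)) ≤
      ENNReal.ofReal C * ∫⁻ θ : sphere (0 : Euc n) 1, A (‖fderiv ℝ w (x₀ + r • (θ : Euc n))‖ / lam)
        ∂(volume : Measure (Euc n)).toSphere := by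
  set W : Euc n → ℝ := fun z => (lam * r)⁻¹ * w (x₀ + r • z) with hW
  have hWd : ContDiff ℝ 1 W :=
    contDiff_const.mul (hw.comp (contDiff_const.add (contDiff_id.const_smul r)))
  have hfd : ∀ z, ‖fderiv ℝ W z‖ = ‖fderiv ℝ w (x₀ + r • z)‖ / lam := by
    intro z
    have h1 : HasFDerivAt (fun z : Euc n => x₀ + r • z) (r • ContinuousLinearMap.id ℝ (Euc n)) z :=
      ((hasFDerivAt_id (𝕜 := ℝ) z).const_smul r).const_add x₀
    have h2 := ((hw.differentiable one_ne_zero (x₀ + r • z)).hasFDerivAt.comp z h1).const_mul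
      (lam * r)⁻¹
    have h3 : fderiv ℝ W z = (lam * r)⁻¹ • (r • fderiv ℝ w (x₀ + r • z)) := by
      refine h2.fderiv.trans ?_
      rw [ContinuousLinearMap.comp_smul, ContinuousLinearMap.comp_id]
    rw [h3, norm_smul, norm_smul, Real.norm_of_nonneg (by positivity), Real.norm_of_nonneg hr.le]
    field_simp
  have hunit : ∀ z ∈ sphere x₀ r, ‖r⁻¹ • (z - x₀)‖ = 1 ∧ x₀ + r • (r⁻¹ • (z - x₀)) = z := by
    intro z hz
    rw [mem_sphere, dist_eq_norm] at hz
    constructor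
    · rw [norm_smul, norm_inv, Real.norm_of_nonneg hr.le, hz, inv_mul_cancel₀ hr.ne']
    · rw [smul_inv_smul₀ hr.ne']; abel
  have h := hsph W hWd _ _ (hunit x hx).1 (hunit y hy).1
  simp_rw [hfd] at h
  refine le_trans (youngShifted_mono hA ?_ ?_ ?_) h
  · exact mem_Ici.2 (by positivity)
  · exact mem_Ici.2 (by positivity)
  · simp only [hW, (hunit x hx).2, (hunit y hy).2]
    rw [← mul_sub, abs_mul, abs_of_pos (inv_pos.2 (mul_pos hlam hr))]
    rw [show d / (lam * C) * (1 / r) = (lam * r)⁻¹ * d / C by field_simp]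
    gcongr

theorem exists_ae_youngShifted_le (hn : 2 ≤ n) : ∃ C : ℝ, 0 < C ∧
    ∀ (A : ℝ → ℝ≥0∞), IsYoung A → ∀ (Ω : Set (Euc n)) (u : Euc n → ℝ) (p : Euc n → Euc n),
    LocallyIntegrableOn u Ω → Measurable p → (∀ i, LocallyIntegrableOn (fun x => p x i) Ω) →
    (∀ φ : Euc n → ℝ, ContDiff ℝ (⊤ : ℕ∞) φ → HasCompactSupport φ → tsupport φ ⊆ Ω →
      ∀ i : Fin n, ∫ x, u x * fderiv ℝ φ x (EuclideanSpace.single i 1) = - ∫ x, p x i * φ x) →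
    WeaklyMonotone Ω u → ∀ (x₀ : Euc n) (R : ℝ), 0 < R → closedBall x₀ (2 * R) ⊆ Ω →
    ∀ lam : ℝ, 0 < lam → ∫⁻ x in closedBall x₀ (2 * R), A (‖p x‖ / lam) ≠ ∞ →
    ∀ δ : ℝ, 0 < δ →
    (∀ r : ℝ, 0 < r → ∀ c : ℝ, ¬ ∀ᵐ x ∂volume.restrict (ball x₀ r), |u x - c| ≤ δ) →
    ∀ᵐ r ∂volume.restrict (Ioo 0 R),
      youngShifted n A (δ / (4 * lam * C) * (1 / r)) ≤
        ENNReal.ofReal C * ∫⁻ θ : sphere (0 : Euc n) 1, A (‖p (x₀ + r • (θ : Euc n))‖ / lam)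
          ∂(volume : Measure (Euc n)).toSphere := by
  obtain ⟨C, hC, hsph⟩ := exists_youngShifted_le_lintegral_sphere hn
  refine ⟨C, hC, ?_⟩
  intro A hA Ω u p hu hp hploc hw hmon x₀ R hR hball lam hlam hF δ hδ hosc
  have : Nonempty (Fin n) := ⟨⟨0, by omega⟩⟩
  have hnt : Nontrivial (Euc n) := inferInstance
  set B := ball x₀ R with hB
  have hBm : MeasurableSet B := measurableSet_ball
  have hBK : B ⊆ closedBall x₀ (2 * R) :=
    ball_subset_closedBall.trans (closedBall_subset_closedBall (by linarith))
  have hKc : IsCompact (closedBall x₀ (2 * R)) := isCompact_closedBall _ _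
  have huB : IntegrableOn u B := (hu.integrableOn_compact_subset hball hKc).mono_set hBK
  have hpK : IntegrableOn p (closedBall x₀ (2 * R)) :=
    Integrable.of_eval_piLp fun i => (hploc i).integrableOn_compact_subset hball hKc
  have hpB : IntegrableOn p B := hpK.mono_set hBK
  obtain ⟨w, hws, hwu, hwp, e, hem, het, hAe⟩ := exists_smooth_approx hA hu hp hploc hw hR hball
    hlam hF
  set u' : Euc n → ℝ := huB.aestronglyMeasurable.mk u with hu'
  have hu'm : Measurable u' := huB.aestronglyMeasurable.stronglyMeasurable_mk.measurable
  have hu'e : u =ᵐ[volume.restrict B] u' := huB.aestronglyMeasurable.ae_eq_mk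
  have hsum := hwu.add het
  rw [add_zero] at hsum
  obtain ⟨ns, hns, hfin⟩ := exists_subseq_tsum_ne_top hsum
  have hnt' : Tendsto ns atTop atTop := hns.tendsto_atTop
  set F : Euc n → ℝ≥0∞ := fun x => ∑' k, B.indicator
    (fun x => ‖w (ns k) x - u' x‖ₑ + e (ns k) x) x with hFd
  have hterm : ∀ k, Measurable (B.indicator (fun x => ‖w (ns k) x - u' x‖ₑ + e (ns k) x)) :=
    fun k => (((hws _).continuous.measurable.sub hu'm).enorm.add (hem _)).indicator hBm
  have hFm : Measurable F := Measurable.tsum hterm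
  have hFfin : ∫⁻ x, F x ≠ ∞ := by
    rw [lintegral_tsum fun k => (hterm k).aemeasurable]
    convert hfin using 3 with k
    rw [lintegral_indicator hBm, lintegral_add_right _ (hem _)]
    congr 1
    refine lintegral_congr_ae ?_
    filter_upwards [hu'e] with x hx
    rw [hx]
  have hFB : ∀ x ∈ B, F x ≠ ∞ → Tendsto (fun k => w (ns k) x) atTop (𝓝 (u' x)) := by
    intro x hx hxF
    have h1 := ENNReal.tendsto_atTop_zero_of_tsum_ne_top hxF
    simp only [indicator_of_mem hx] at h1
    rw [tendsto_iff_enorm_sub_tendsto_zero]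
    exact tendsto_of_tendsto_of_tendsto_of_le_of_le tendsto_const_nhds h1 (fun k => zero_le)
      fun k => le_self_add
  have hae : ∀ᵐ x ∂volume.restrict B, Tendsto (fun k => w (ns k) x) atTop (𝓝 (u x)) := by
    filter_upwards [hu'e, ae_restrict_of_ae (ae_lt_top hFm hFfin), ae_restrict_mem hBm]
      with x h1 h2 h3
    rw [h1]
    exact hFB x h3 h2.ne
  have hF' : ∫⁻ x, F (x₀ + x) ≠ ∞ := by rwa [lintegral_add_left_eq_self F x₀]
  have hF'm : Measurable fun x => F (x₀ + x) := hFm.comp (measurable_const_add x₀)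
  rw [lintegral_eq_lintegral_radius volume hF'm] at hF'
  have hrm : Measurable fun r : ℝ => ∫⁻ θ : sphere (0 : Euc n) 1, F (x₀ + r • (θ : Euc n))
      ∂(volume : Measure (Euc n)).toSphere := by
    refine Measurable.lintegral_prod_right' (f := fun z : ℝ × sphere (0 : Euc n) 1 =>
      F (x₀ + z.1 • (z.2 : Euc n))) (hFm.comp ?_)
    fun_prop
  have har := ae_lt_top' (by
    refine Measurable.aemeasurable (Measurable.mul ?_ hrm)
    fun_prop) hF'
  have har' := ae_restrict_of_ae_restrict_of_subset (fun r (hr : r ∈ Ioo 0 R) => hr.1) har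
  filter_upwards [har', ae_restrict_mem measurableSet_Ioo] with r hr hrR
  have hr0 : 0 < r := hrR.1
  have hrF : ∫⁻ θ : sphere (0 : Euc n) 1, F (x₀ + r • (θ : Euc n))
      ∂(volume : Measure (Euc n)).toSphere ≠ ∞ := by
    refine (ENNReal.lt_top_of_mul_ne_top_right hr.ne ?_).ne
    exact (ENNReal.ofReal_pos.2 (by positivity)).ne'
  have hmem : ∀ θ : sphere (0 : Euc n) 1, x₀ + r • (θ : Euc n) ∈ sphere x₀ r := by
    intro θ
    have : ‖(θ : Euc n)‖ = 1 := mem_sphere_zero_iff_norm.1 θ.2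
    rw [mem_sphere, dist_eq_norm, add_sub_cancel_left, norm_smul, this, Real.norm_of_nonneg hr0.le,
      mul_one]
  have hsB : sphere x₀ r ⊆ B := fun x hx => by
    rw [hB, mem_ball, mem_sphere.1 hx]; exact hrR.2
  have hemr : ∀ k, Measurable fun θ : sphere (0 : Euc n) 1 => e k (x₀ + r • (θ : Euc n)) :=
    fun k => (hem k).comp (by fun_prop)
  -- the errors vanish on the sphere
  have heθ : Tendsto (fun k => ∫⁻ θ : sphere (0 : Euc n) 1, e (ns k) (x₀ + r • (θ : Euc n))
      ∂(volume : Measure (Euc n)).toSphere) atTop (𝓝 0) := by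
    have h1 : ∑' k, ∫⁻ θ : sphere (0 : Euc n) 1, e (ns k) (x₀ + r • (θ : Euc n))
      ∂(volume : Measure (Euc n)).toSphere ≠ ∞ := by
      rw [← lintegral_tsum fun k => (hemr (ns k)).aemeasurable]
      refine ne_top_of_le_ne_top hrF (lintegral_mono fun θ => ENNReal.tsum_le_tsum fun k => ?_)
      rw [indicator_of_mem (hsB (hmem θ))]
      exact le_add_self
    exact ENNReal.tendsto_atTop_zero_of_tsum_ne_top h1
  -- the approximations converge somewhere on the sphere
  obtain ⟨θ₀, hθ₀⟩ : ∃ θ₀ : sphere (0 : Euc n) 1, F (x₀ + r • (θ₀ : Euc n)) ≠ ∞ := by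
    by_contra! hcon
    refine hrF ?_
    simp_rw [hcon]
    rw [lintegral_const, ENNReal.top_mul]
    rw [Measure.measure_univ_ne_zero]
    exact Measure.toSphere_ne_zero _
  have hconv := hFB _ (hsB (hmem θ₀)) hθ₀
  set c := u' (x₀ + r • (θ₀ : Euc n)) with hc
  -- the oscillation on the sphere is large infinitely often
  have hfreq : ∃ᶠ k in atTop, ∃ x ∈ sphere x₀ r, ∃ y ∈ sphere x₀ r,
      δ / 2 ≤ |w (ns k) x - w (ns k) y| := by
    by_contra hcon
    rw [not_frequently] at hcon
    refine hosc r hr0 c ?_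
    have hrB : ball x₀ r ⊆ B := ball_subset_ball hrR.2.le
    have hclK : closedBall x₀ r ⊆ Ω :=
      (closedBall_subset_closedBall (by linarith [hrR.2])).trans hball
    have hle := Measure.restrict_mono (μ := (volume : Measure (Euc n))) hrB le_rfl
    have hmem110 := memW110_truncation (x₀ := x₀) (r := r) (w := fun k => w (ns k))
      (m := c - δ) (M := c + δ) (huB.mono_set hrB) (hpB.mono_set hrB) (fun k => hws _)
      (tendsto_of_tendsto_of_tendsto_of_le_of_le tendsto_const_nhds (hwu.comp hnt')
        (fun k => zero_le) fun k => lintegral_mono' hle le_rfl)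
      (tendsto_of_tendsto_of_tendsto_of_le_of_le tendsto_const_nhds (hwp.comp hnt')
        (fun k => zero_le) fun k => lintegral_mono' hle le_rfl)
      (ae_restrict_of_ae_restrict_of_subset hrB hae) (by
        have h1 := (Metric.tendsto_nhds.1 hconv) (δ / 2) (by positivity)
        filter_upwards [hcon, h1] with k h2 h3 x hx
        push Not at h2
        have h4 := h2 x hx _ (hmem θ₀)
        rw [Real.dist_eq] at h3
        rw [abs_lt] at h3 h4
        constructor <;> linarith [h3.1, h3.2, h4.1, h4.2])
    have := hmon (ball x₀ r) isOpen_ball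
      ((isCompact_closedBall x₀ r).of_isClosed_subset isClosed_closure closure_ball_subset_closedBall)
      (closure_ball_subset_closedBall.trans hclK) (c - δ) (c + δ) (by linarith) hmem110
    filter_upwards [this] with x hx
    rw [abs_le]
    constructor <;> linarith [hx.1, hx.2]
  have hlim : Tendsto (fun k => ENNReal.ofReal C *
      (∫⁻ θ : sphere (0 : Euc n) 1, A (‖p (x₀ + r • (θ : Euc n))‖ / lam)
          ∂(volume : Measure (Euc n)).toSphere +
        ∫⁻ θ : sphere (0 : Euc n) 1, e (ns k) (x₀ + r • (θ : Euc n))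
          ∂(volume : Measure (Euc n)).toSphere)) atTop (𝓝 (ENNReal.ofReal C *
      ∫⁻ θ : sphere (0 : Euc n) 1, A (‖p (x₀ + r • (θ : Euc n))‖ / lam)
          ∂(volume : Measure (Euc n)).toSphere)) := by
    have := ENNReal.Tendsto.const_mul ((tendsto_const_nhds
      (x := ∫⁻ θ : sphere (0 : Euc n) 1, A (‖p (x₀ + r • (θ : Euc n))‖ / lam)
        ∂(volume : Measure (Euc n)).toSphere)).add heθ) (a := ENNReal.ofReal C)
      (Or.inr ENNReal.ofReal_ne_top)
    simpa using this
  refine ge_of_tendsto_of_frequently hlim (hfreq.mono fun k ⟨x, hx, y, hy, hxy⟩ => ?_)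
  have h1 := youngShifted_le_of_sphere hA hC (hsph A hA)
    ((hws (ns k)).of_le (by exact_mod_cast le_top)) hr0 (mul_pos two_pos hlam) hx hy
    (by positivity) hxy
  rw [show δ / 2 / (2 * lam * C) = δ / (4 * lam * C) by field_simp; norm_num] at h1
  refine h1.trans ?_
  gcongr
  rw [← lintegral_add_right _ (hemr (ns k))]
  exact lintegral_mono fun θ => hAe _ _ (hsB (hmem θ))

end OscillationOnSpheres

section Divergence

variable {n : ℕ}

theorem lintegral_Ioo_comp_inv {R : ℝ} (hR : 0 < R) (f : ℝ → ℝ≥0∞) :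
    ∫⁻ t in Ioi R⁻¹, f t = ∫⁻ r in Ioo 0 R, ENNReal.ofReal (r ^ 2)⁻¹ * f r⁻¹ := by
  rw [← inv_Ioo_0_left hR, ← image_inv_eq_inv, lintegral_image_eq_lintegral_abs_deriv_mul
    measurableSet_Ioo (fun r hr => (hasDerivAt_inv hr.1.ne').hasDerivWithinAt) inv_injective.injOn]
  refine setLIntegral_congr_fun measurableSet_Ioo fun r hr => ?_
  have : (0 : ℝ) ≤ (r ^ 2)⁻¹ := by positivity
  simp only [abs_neg, abs_of_nonneg this]

theorem lintegral_mul_rieszKernel_eq_top (hn : 2 ≤ n) {σ : ℝ → ℝ} (hσ : ContinuousOn σ (Ici 0))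
    {Y : ℝ → ℝ≥0∞} (hY : MonotoneOn Y (Ici 0)) {kap : ℝ}
    (hdiv : ∀ c : ℝ, 0 < c →
      ∫⁻ t in Ioi c, Y (kap * t) / (ENNReal.ofReal (t * σ t) * Y t) = ∞)
    {G : Euc n → ℝ≥0∞} (hG : Measurable G) {x₀ : Euc n} {R C : ℝ} (hR : 0 < R)
    (hle : ∀ᵐ r ∂volume.restrict (Ioo 0 R), Y (kap * (1 / r)) ≤
      ENNReal.ofReal C * ∫⁻ θ : sphere (0 : Euc n) 1, G (x₀ + r • (θ : Euc n))
        ∂(volume : Measure (Euc n)).toSphere) :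
    ∫⁻ y in ball x₀ R, G y * rieszKernel (fun t => ENNReal.ofReal (σ t) * Y t) x₀ y = ∞ := by
  have : Nonempty (Fin n) := ⟨⟨0, by omega⟩⟩
  have hnt : Nontrivial (Euc n) := inferInstance
  set Φ : ℝ → ℝ≥0∞ := fun t => ENNReal.ofReal (σ (max t 0)) * Y (max t 0) with hΦ
  have hΦm : Measurable Φ := by
    refine Measurable.mul (Measurable.ennreal_ofReal ?_) ?_
    · exact (hσ.comp_continuous (by fun_prop) fun t => le_max_right t 0).measurable
    · exact Monotone.measurable fun s t hst => hY (mem_Ici.2 (le_max_right _ _))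
        (mem_Ici.2 (le_max_right _ _)) (max_le_max_right 0 hst)
  have hΦe : ∀ t, 0 ≤ t → Φ t = ENNReal.ofReal (σ t) * Y t := fun t ht => by
    simp only [hΦ, max_eq_left ht]
  set K : ℝ → ℝ≥0∞ := fun r => (ENNReal.ofReal (r ^ n) * Φ (1 / r))⁻¹ with hK
  have hKm : Measurable K := by
    refine Measurable.inv (Measurable.mul (by fun_prop) (hΦm.comp (by fun_prop)))
  set H : Euc n → ℝ≥0∞ := fun z => (ball x₀ R).indicator G (x₀ + z) * K ‖z‖ with hH
  have hHm : Measurable H :=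
    ((hG.indicator measurableSet_ball).comp (measurable_const_add x₀)).mul (hKm.comp measurable_norm)
  have e1 : ∫⁻ y in ball x₀ R, G y * rieszKernel (fun t => ENNReal.ofReal (σ t) * Y t) x₀ y =
      ∫⁻ z, H z := by
    rw [← lintegral_indicator measurableSet_ball,
      ← lintegral_add_left_eq_self ((ball x₀ R).indicator _) x₀]
    refine lintegral_congr fun z => ?_
    by_cases hz : x₀ + z ∈ ball x₀ R
    · simp only [hH, indicator_of_mem hz, hK, rieszKernel, sub_add_cancel_left, norm_neg]
      rw [hΦe _ (by positivity)]
    · simp only [hH, indicator_of_notMem hz, zero_mul]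
  rw [e1, lintegral_eq_lintegral_radius volume hHm, finrank_euclideanSpace_fin]
  have hCtop : ENNReal.ofReal C * (∫⁻ r in Ioi (0 : ℝ), ENNReal.ofReal (r ^ (n - 1)) *
      ∫⁻ θ : sphere (0 : Euc n) 1, H (r • (θ : Euc n)) ∂(volume : Measure (Euc n)).toSphere) = ∞ := by
    rw [← top_le_iff, ← hdiv R⁻¹ (inv_pos.2 hR), lintegral_Ioo_comp_inv hR,
      ← lintegral_const_mul' _ _ ENNReal.ofReal_ne_top]
    refine le_trans ?_ (lintegral_mono_set fun r (hr : r ∈ Ioo 0 R) => hr.1)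
    refine lintegral_mono_ae ?_
    filter_upwards [hle, ae_restrict_mem measurableSet_Ioo] with r hr hrR
    have hr0 : 0 < r := hrR.1
    have hnorm : ∀ θ : sphere (0 : Euc n) 1, ‖r • (θ : Euc n)‖ = r := by
      intro θ
      have : ‖(θ : Euc n)‖ = 1 := mem_sphere_zero_iff_norm.1 θ.2
      rw [norm_smul, this, Real.norm_of_nonneg hr0.le, mul_one]
    have hHr : ∀ θ : sphere (0 : Euc n) 1, H (r • (θ : Euc n)) =
        G (x₀ + r • (θ : Euc n)) * K r := by
      intro θ
      have hm : x₀ + r • (θ : Euc n) ∈ ball x₀ R := by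
        rw [mem_ball, dist_eq_norm, add_sub_cancel_left, hnorm]; exact hrR.2
      simp only [hH, indicator_of_mem hm, hnorm]
    simp_rw [hHr]
    have hGr : Measurable fun θ : sphere (0 : Euc n) 1 => G (x₀ + r • (θ : Euc n)) :=
      hG.comp (by fun_prop)
    rw [lintegral_mul_const _ hGr]
    rw [one_div] at hr
    set Z := ENNReal.ofReal (σ r⁻¹) * Y r⁻¹ with hZ
    have hr0' : ENNReal.ofReal r ≠ 0 := (ENNReal.ofReal_pos.2 hr0).ne'
    have hKr : ENNReal.ofReal (r ^ (n - 1)) * K r = (ENNReal.ofReal r)⁻¹ * Z⁻¹ := by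
      have h1 : ENNReal.ofReal (r ^ n) = ENNReal.ofReal (r ^ (n - 1)) * ENNReal.ofReal r := by
        rw [← ENNReal.ofReal_mul (by positivity), ← pow_succ, Nat.sub_add_cancel (by omega)]
      have h2 : ENNReal.ofReal (r ^ (n - 1)) ≠ 0 := (ENNReal.ofReal_pos.2 (by positivity)).ne'
      simp only [hK]
      rw [hΦe _ (by positivity), one_div, ← hZ, h1, mul_assoc,
        ENNReal.mul_inv (Or.inl h2) (Or.inl ENNReal.ofReal_ne_top),
        ENNReal.mul_inv (Or.inl hr0') (Or.inl ENNReal.ofReal_ne_top), ← mul_assoc,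
        ENNReal.mul_inv_cancel h2 ENNReal.ofReal_ne_top, one_mul]
    have hden : ENNReal.ofReal (r ^ 2)⁻¹ * (ENNReal.ofReal (r⁻¹ * σ r⁻¹) * Y r⁻¹)⁻¹ =
        (ENNReal.ofReal r)⁻¹ * Z⁻¹ := by
      rw [ENNReal.ofReal_mul (inv_nonneg.2 hr0.le), mul_assoc, ← hZ,
        ENNReal.ofReal_inv_of_pos hr0, ENNReal.ofReal_inv_of_pos (by positivity),
        ENNReal.mul_inv (Or.inl (ENNReal.inv_ne_zero.2 ENNReal.ofReal_ne_top))
          (Or.inl (ENNReal.inv_ne_top.2 hr0')), inv_inv, ← mul_assoc, sq,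
        ENNReal.ofReal_mul hr0.le, ENNReal.mul_inv (Or.inl hr0') (Or.inl ENNReal.ofReal_ne_top),
        mul_assoc (ENNReal.ofReal r)⁻¹, ENNReal.inv_mul_cancel hr0' ENNReal.ofReal_ne_top, mul_one]
    calc ENNReal.ofReal (r ^ 2)⁻¹ * (Y (kap * r⁻¹) / (ENNReal.ofReal (r⁻¹ * σ r⁻¹) * Y r⁻¹))
        = Y (kap * r⁻¹) * (ENNReal.ofReal (r ^ 2)⁻¹ *
            (ENNReal.ofReal (r⁻¹ * σ r⁻¹) * Y r⁻¹)⁻¹) := by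
          rw [ENNReal.div_eq_inv_mul]; ring
      _ ≤ _ := by
          rw [hden, ← hKr]
          refine (mul_le_mul_left hr _).trans (le_of_eq ?_)
          ring
  by_contra hne
  exact ENNReal.mul_ne_top ENNReal.ofReal_ne_top hne hCtop

end Divergence

section Capacity

variable {n : ℕ}

theorem capPsi_eq_zero_of_rieszPot_eq_top {Ψ : ℝ → ℝ≥0∞} {S : Set (Euc n)} {f : Euc n → ℝ≥0∞}
    (hf : Measurable f) (hfin : ∫⁻ x, f x ≠ ∞) (h : ∀ x ∈ S, rieszPot Ψ f x = ∞) :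
    capPsi Ψ S = 0 := by
  have hle : ∀ k : ℕ, capPsi Ψ S ≤ (k : ℝ≥0∞)⁻¹ * ∫⁻ x, f x := by
    intro k
    have hk : (k : ℝ≥0∞)⁻¹ ≠ 0 := ENNReal.inv_ne_zero.2 (ENNReal.natCast_ne_top k)
    rw [← lintegral_const_mul _ hf]
    refine iInf₂_le_of_le (fun x => (k : ℝ≥0∞)⁻¹ * f x) (hf.const_mul _)
      (iInf_le_of_le (fun x hx => ?_) le_rfl)
    refine le_of_le_of_eq le_top (top_le_iff.1 ?_).symm
    calc ∞ = (k : ℝ≥0∞)⁻¹ * rieszPot Ψ f x := by rw [h x hx, ENNReal.mul_top hk]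
      _ ≤ ∫⁻ y, (k : ℝ≥0∞)⁻¹ * (f y * rieszKernel Ψ x y) := lintegral_const_mul_le _ _
      _ = rieszPot Ψ (fun x => (k : ℝ≥0∞)⁻¹ * f x) x := by simp only [rieszPot, mul_assoc]
  have hlim : Tendsto (fun k : ℕ => (k : ℝ≥0∞)⁻¹ * ∫⁻ x, f x) atTop (𝓝 0) := by
    simpa using ENNReal.Tendsto.mul_const ENNReal.tendsto_inv_nat_nhds_zero (Or.inr hfin)
  exact le_antisymm (ge_of_tendsto' hlim hle) zero_le

end Capacity

section Representative

variable {X : Type*} [TopologicalSpace X] [MeasurableSpace X] {μ : Measure X}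

theorem nhds_inf_ae_neBot [μ.IsOpenPosMeasure] (x : X) : (𝓝 x ⊓ ae μ).NeBot := by
  rw [inf_neBot_iff]
  intro s hs t ht
  by_contra hne
  rw [not_nonempty_iff_eq_empty, ← disjoint_iff_inter_eq_empty] at hne
  exact (Measure.measure_pos_of_mem_nhds μ hs).ne'
    (measure_mono_null hne.subset_compl_right (mem_ae_iff.1 ht))

/-- A function has a representative that is continuous on the set where its essential
oscillation vanishes. -/
theorem exists_ae_eq_continuousOn [SecondCountableTopology X] [OpensMeasurableSpace X]
    [μ.IsOpenPosMeasure] (u : X → ℝ) {G : Set X}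
    (hG : ∀ x ∈ G, ∀ δ : ℝ, 0 < δ → ∃ V : Set X, IsOpen V ∧ x ∈ V ∧ ∃ c : ℝ,
      ∀ᵐ y ∂μ.restrict V, |u y - c| ≤ δ) :
    ∃ v : X → ℝ, v =ᵐ[μ] u ∧ ContinuousOn v G := by
  classical
  have hev : ∀ x, ∀ V : Set X, IsOpen V → x ∈ V → ∀ c δ : ℝ,
      (∀ᵐ y ∂μ.restrict V, |u y - c| ≤ δ) → ∀ᶠ y in 𝓝 x ⊓ ae μ, |u y - c| ≤ δ := by
    intro x V hV hx c δ h
    rw [ae_restrict_iff' hV.measurableSet] at h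
    filter_upwards [mem_inf_of_left (hV.mem_nhds hx), mem_inf_of_right h] with y h1 h2 using h2 h1
  have hL : ∀ x, ∃ L : ℝ, x ∈ G → Tendsto u (𝓝 x ⊓ ae μ) (𝓝 L) := by
    intro x
    by_cases hx : x ∈ G
    swap
    · exact ⟨0, fun h => absurd h hx⟩
    have hne := nhds_inf_ae_neBot (μ := μ) x
    have hc : Cauchy (map u (𝓝 x ⊓ ae μ)) := by
      rw [Metric.cauchy_iff]
      refine ⟨inferInstance, fun ε hε => ?_⟩
      obtain ⟨V, hV, hxV, c, hc⟩ := hG x hx (ε / 3) (by positivity)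
      refine ⟨{s | |s - c| ≤ ε / 3}, hev x V hV hxV c _ hc, fun s hs t ht => ?_⟩
      have h1 := abs_le.1 (mem_ofPred.1 hs)
      have h2 := abs_le.1 (mem_ofPred.1 ht)
      rw [Real.dist_eq, abs_lt]
      constructor <;> linarith [h1.1, h1.2, h2.1, h2.2]
    obtain ⟨L, hL⟩ := CompleteSpace.complete hc
    exact ⟨L, fun _ => hL⟩
  choose L hL using hL
  have hLc : ∀ x ∈ G, ∀ V : Set X, IsOpen V → x ∈ V → ∀ c δ : ℝ,
      (∀ᵐ y ∂μ.restrict V, |u y - c| ≤ δ) → |L x - c| ≤ δ := by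
    intro x hx V hV hxV c δ h
    have hne := nhds_inf_ae_neBot (μ := μ) x
    exact le_of_tendsto ((hL x hx).sub_const c).abs (hev x V hV hxV c δ h)
  refine ⟨fun x => if x ∈ G then L x else u x, ?_, ?_⟩
  · have hk : ∀ k : ℕ, ∀ᵐ y ∂μ, y ∈ G → |L y - u y| ≤ 2 * (1 / ((k : ℝ) + 1)) := by
      intro k
      choose! V hV hxV c hc using fun x hx => hG x hx (1 / ((k : ℝ) + 1)) (by positivity)
      obtain ⟨t, htG, htc, hcov⟩ := TopologicalSpace.countable_cover_nhdsWithin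
        (fun x hx => mem_nhdsWithin_of_mem_nhds ((hV x hx).mem_nhds (hxV x hx)))
      have hall : ∀ᵐ y ∂μ, ∀ x ∈ t, y ∈ V x → |u y - c x| ≤ 1 / ((k : ℝ) + 1) := by
        rw [ae_ball_iff htc]
        intro x hx
        exact (ae_restrict_iff' (hV x (htG hx)).measurableSet).1 (hc x (htG hx))
      filter_upwards [hall] with y hy hyG
      obtain ⟨x, hxt, hyx⟩ := mem_iUnion₂.1 (hcov hyG)
      have h1 := abs_le.1 (hy x hxt hyx)
      have h2 := abs_le.1 (hLc y hyG (V x) (hV x (htG hxt)) hyx (c x) _ (hc x (htG hxt)))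
      rw [abs_le]
      constructor <;> linarith [h1.1, h1.2, h2.1, h2.2]
    filter_upwards [ae_all_iff.2 hk] with y hy
    split_ifs with hyG
    · have hlim : Tendsto (fun k : ℕ => 2 * (1 / ((k : ℝ) + 1))) atTop (𝓝 0) := by
        simpa using tendsto_one_div_add_atTop_nhds_zero_nat.const_mul (2 : ℝ)
      have := ge_of_tendsto' hlim fun k => hy k hyG
      exact sub_eq_zero.1 (abs_nonpos_iff.1 this)
    · rfl
  · intro x hx
    rw [Metric.continuousWithinAt_iff']
    intro ε hε
    obtain ⟨V, hV, hxV, c, hc⟩ := hG x hx (ε / 3) (by positivity)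
    filter_upwards [mem_nhdsWithin_of_mem_nhds (hV.mem_nhds hxV), self_mem_nhdsWithin]
      with y hyV hyG
    have h1 := abs_le.1 (hLc x hx V hV hxV c _ hc)
    have h2 := abs_le.1 (hLc y hyG V hV hyV c _ hc)
    rw [if_pos hx, if_pos hyG, Real.dist_eq, abs_lt]
    constructor <;> linarith [h1.1, h1.2, h2.1, h2.2]

end Representative

theorem weaklyMonotone_continuous_off_capacity_zero {n : ℕ} (hn : 2 ≤ n)
    (Ω : Set (Euc n)) (hΩ : IsOpen Ω)
    (A : ℝ → ℝ≥0∞) (hA : IsYoung A) (hT : 3 ≤ n → TailCondition n A)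
    (σ : ℝ → ℝ) (hσcont : ContinuousOn σ (Ici 0))
    (hσnonneg : ∀ t ∈ Ici (0 : ℝ), 0 ≤ σ t)
    (hdiv : ∀ lam : ℝ, 0 < lam → ∀ c : ℝ, 0 < c →
      ∫⁻ t in Ioi c,
        youngShifted n A (lam * t) /
          (ENNReal.ofReal (t * σ t) * youngShifted n A t) = ∞)
    (u : Euc n → ℝ) (g : Euc n → Euc n) (hu : MemW1Aloc A Ω u g)
    (hmon : WeaklyMonotone Ω u) :
    ∃ v : Euc n → ℝ, (∀ᵐ x ∂volume.restrict Ω, v x = u x) ∧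
      ∃ S : Set (Euc n),
        capPsi (fun t => ENNReal.ofReal (σ t) * youngShifted n A t) S = 0 ∧
        ContinuousOn v (Ω \ S) := by
  obtain ⟨p, hpm, hploc, hw, hpg⟩ := exists_measurable_weakGrad hΩ hu.1
  obtain ⟨C, hC, hosc⟩ := exists_ae_youngShifted_le hn
  set S : Set (Euc n) := {x | x ∈ Ω ∧ ∃ δ : ℝ, 0 < δ ∧ ∀ r : ℝ, 0 < r → ∀ c : ℝ,
    ¬ ∀ᵐ y ∂volume.restrict (ball x r), |u y - c| ≤ δ} with hS
  obtain ⟨v, hvu, hv⟩ := exists_ae_eq_continuousOn (μ := volume) u (G := Ω \ S) (by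
    rintro x ⟨hxΩ, hxS⟩ δ hδ
    by_contra hcon
    exact hxS ⟨hxΩ, δ, hδ, fun r hr c h =>
      hcon ⟨_, isOpen_ball, mem_ball_self hr, c, h⟩⟩)
  refine ⟨v, ae_restrict_of_ae hvu, S, ?_, hv⟩
  -- a countable cover by balls on which the gradient is integrable
  have hcover : ∀ x ∈ Ω, ∃ ρ : ℝ, 0 < ρ ∧ ball x ρ ⊆ Ω ∧ ∃ lam : ℝ, 0 < lam ∧
      ∫⁻ y in ball x ρ, A (‖p y‖ / lam) ≠ ∞ := by
    intro x hx
    obtain ⟨ρ, hρ, hρΩ⟩ := Metric.nhds_basis_closedBall.mem_iff.1 (hΩ.mem_nhds hx)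
    obtain ⟨lam, hlam, hfin⟩ := (hu.2 (ball x ρ) isOpen_ball
      ((isCompact_closedBall x ρ).of_isClosed_subset isClosed_closure closure_ball_subset_closedBall)
      (closure_ball_subset_closedBall.trans hρΩ)).2
    have hsub : ball x ρ ⊆ Ω := ball_subset_closedBall.trans hρΩ
    refine ⟨ρ, hρ, hsub, lam, hlam, ne_top_of_le_ne_top hfin.ne (lintegral_mono_ae ?_)⟩
    filter_upwards [ae_restrict_of_ae_restrict_of_subset hsub hpg] with y hy
    rw [abs_of_nonneg (norm_nonneg _)]
    exact hA.mono (by positivity) (by gcongr)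
  choose! ρ hρ hρΩ lam hlam hfin using hcover
  obtain ⟨t, htΩ, htc, hcov⟩ := TopologicalSpace.countable_cover_nhdsWithin
    (fun x hx => mem_nhdsWithin_of_mem_nhds (ball_mem_nhds x (hρ x hx)))
  have : Countable t := htc.to_subtype
  obtain ⟨ε, hε0, hε⟩ := ENNReal.exists_pos_sum_of_countable' (one_ne_zero (α := ℝ≥0∞)) t
  set J : t → ℝ≥0∞ := fun i => ∫⁻ y in ball (i : Euc n) (ρ i), A (‖p y‖ / lam i) with hJ
  have hAm : ∀ x ∈ Ω, Measurable fun y => A (‖p y‖ / lam x) := fun x hx =>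
    hA.measurable_comp (hpm.norm.div_const _) fun y => div_nonneg (norm_nonneg _) (hlam x hx).le
  set F : t → Euc n → ℝ≥0∞ := fun i y => ε i / (1 + J i) *
    (ball (i : Euc n) (ρ i)).indicator (fun y => A (‖p y‖ / lam i)) y with hF
  have hFm : ∀ i, Measurable (F i) := fun i =>
    ((hAm i (htΩ i.2)).indicator measurableSet_ball).const_mul _
  have hJfin : ∀ i, 1 + J i ≠ ∞ := fun i =>
    ENNReal.add_ne_top.2 ⟨ENNReal.one_ne_top, hfin i (htΩ i.2)⟩
  refine capPsi_eq_zero_of_rieszPot_eq_top (f := fun y => ∑' i, F i y) (Measurable.tsum hFm) ?_ ?_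
  · rw [lintegral_tsum fun i => (hFm i).aemeasurable]
    refine ne_top_of_le_ne_top (hε.trans_le le_top).ne (ENNReal.tsum_le_tsum fun i => ?_)
    rw [lintegral_const_mul _ ((hAm i (htΩ i.2)).indicator measurableSet_ball),
      lintegral_indicator measurableSet_ball]
    calc ε i / (1 + J i) * J i ≤ ε i / (1 + J i) * (1 + J i) := by
          gcongr
          exact le_add_self
      _ = ε i := ENNReal.div_mul_cancel (by simp) (hJfin i)
  · rintro x ⟨hxΩ, δ, hδ, hx⟩
    obtain ⟨i, hit, hxi⟩ := mem_iUnion₂.1 (hcov hxΩ)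
    have hiΩ := htΩ hit
    obtain ⟨R', hR', hR'sub⟩ := Metric.nhds_basis_closedBall.mem_iff.1
      (isOpen_ball.mem_nhds hxi)
    obtain ⟨R, rfl⟩ : ∃ R, R' = 2 * R := ⟨R' / 2, by ring⟩
    have hR : 0 < R := by linarith
    have hlami := hlam i hiΩ
    have hae := hosc A hA Ω u p hu.1.1 hpm hploc hw hmon x R hR (hR'sub.trans (hρΩ i hiΩ))
      (lam i) hlami (ne_top_of_le_ne_top (hfin i hiΩ) (lintegral_mono_set hR'sub)) δ hδ hx
    have htop := lintegral_mul_rieszKernel_eq_top hn hσcont (youngShifted_mono hA)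
      (hdiv (δ / (4 * lam i * C)) (by positivity)) (hAm i hiΩ) hR hae
    have hsub : ball x R ⊆ ball i (ρ i) := (ball_subset_closedBall.trans
      (closedBall_subset_closedBall (by linarith))).trans hR'sub
    have hpos : ε ⟨i, hit⟩ / (1 + J ⟨i, hit⟩) ≠ 0 :=
      (ENNReal.div_pos (hε0 _).ne' (hJfin _)).ne'
    set K := rieszKernel (n := n) (fun t => ENNReal.ofReal (σ t) * youngShifted n A t) with hK
    rw [← top_le_iff]
    calc ∞ = ε ⟨i, hit⟩ / (1 + J ⟨i, hit⟩) * ∫⁻ y in ball x R, A (‖p y‖ / lam i) * K x y := by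
          rw [htop, ENNReal.mul_top hpos]
      _ ≤ ∫⁻ y in ball x R, ε ⟨i, hit⟩ / (1 + J ⟨i, hit⟩) * (A (‖p y‖ / lam i) * K x y) :=
          lintegral_const_mul_le _ _
      _ = ∫⁻ y in ball x R, F ⟨i, hit⟩ y * K x y :=
          setLIntegral_congr_fun measurableSet_ball fun y hy => by
            simp only [hF, indicator_of_mem (hsub hy), mul_assoc]
      _ ≤ ∫⁻ y in ball x R, (∑' j, F j y) * K x y := by
          gcongr with y
          exact ENNReal.le_tsum (⟨i, hit⟩ : t)
      _ ≤ ∫⁻ y, (∑' j, F j y) * K x y := setLIntegral_le_lintegral _ _
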